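/- Let 0 < λ ≤ 2, ν > 0 and ν + λ > 1. Then for every φ ∈ (0,π), | (sin φ)^λ · ʳG_ν^{(λ)}(cos φ) − (2^λ Γ(λ+1/2))/(√π (ν+λ)^λ) · cos((ν+λ)φ − λπ/2) | ≤ (λ |λ−1| 2^λ Γ(λ+1/2))/(√π (ν+λ−1)^{λ+1}) · ( |cot φ| + (2/3)·(λ+1)/(ν+λ−1) ). -/

import Mathlib

open Real

/-- Pochhammer symbol `(a)_n = a (a+1) ⋯ (a+n-1)` for a real base. -/
noncomputable def poch (a : ℝ) (n : ℕ) : ℝ := ∏ i ∈ Finset.range n, (a + (i : ℝ))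

/-- The right generalized Gegenbauer function of fractional degree. -/
noncomputable def rG (lam nu x : ℝ) : ℝ :=
  ∑' j : ℕ, (poch (-nu) j * poch (nu + 2 * lam) j /
    ((j.factorial : ℝ) * poch (lam + 1 / 2) j)) * ((1 - x) / 2) ^ j


open Filter Topology MeasureTheory

/-- hypergeometric coefficients -/
noncomputable def hc (a b c : ℝ) (k : ℕ) : ℝ :=
  poch a k * poch b k / ((k.factorial : ℝ) * poch c k)

lemma poch_succ (a : ℝ) (k : ℕ) : poch a (k+1) = poch a k * (a + k) := by
  simp [poch, Finset.prod_range_succ]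

lemma poch_zero (a : ℝ) : poch a 0 = 1 := by simp [poch]

lemma poch_pos {a : ℝ} (ha : 0 < a) (k : ℕ) : 0 < poch a k :=
  Finset.prod_pos (fun i _ => by positivity)

lemma hc_zero (a b c : ℝ) : hc a b c 0 = 1 := by simp [hc, poch_zero]

lemma hc_succ (a b : ℝ) {c : ℝ} (hc0 : 0 < c) (k : ℕ) :
    ((k:ℝ) + 1) * (c + k) * hc a b c (k+1) = (a + k) * (b + k) * hc a b c k := by
  have h1 := (poch_pos hc0 k).ne'
  have h2 : c + k ≠ 0 := by positivity
  have h3 : (k.factorial : ℝ) ≠ 0 := by positivity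
  have h4 : (k:ℝ) + 1 ≠ 0 := by positivity
  simp only [hc, poch_succ, Nat.factorial_succ, Nat.cast_mul, Nat.cast_add, Nat.cast_one]
  field_simp

lemma hc_summable (a b : ℝ) {c : ℝ} (hc0 : 0 < c) (x : ℝ) (hx : |x| < 1) :
    Summable (fun k => hc a b c k * x ^ k) := by
  obtain ⟨r, hr1, hr2⟩ := exists_between hx
  apply summable_of_ratio_norm_eventually_le hr2
  have hr0 : 0 < r := (abs_nonneg x).trans_lt hr1
  have key : Tendsto (fun k : ℕ => |a + k| * |b + k| / (((k:ℝ)+1) * (c + k)) * |x|) atTop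
      (𝓝 (1 * 1 * |x|)) := by
    have h0 : ∀ d : ℝ, Tendsto (fun k : ℕ => d + (k:ℝ)) atTop atTop := fun d =>
      tendsto_atTop_add_const_left _ _ tendsto_natCast_atTop_atTop
    have h1 : ∀ d e : ℝ, Tendsto (fun k : ℕ => |d + k| / (e + k)) atTop (𝓝 1) := by
      intro d e
      have h2 : Tendsto (fun k : ℕ => 1 + (d - e) / (e + k)) atTop (𝓝 (1 + 0)) :=
        tendsto_const_nhds.add (tendsto_const_nhds.div_atTop (h0 e))
      rw [add_zero] at h2
      refine h2.congr' ?_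
      filter_upwards [(h0 e).eventually_gt_atTop 0, (h0 d).eventually_gt_atTop 0] with k hk hk'
      rw [abs_of_pos hk']
      field_simp
      ring
    refine (((h1 a 1).mul (h1 b c)).mul_const |x|).congr ?_
    intro k
    rw [div_mul_div_comm, add_comm (1:ℝ)]
  rw [one_mul, one_mul] at key
  filter_upwards [key.eventually_lt_const hr1] with k hk
  have h1 := hc_succ a b hc0 k
  have h2 : 0 < c + k := by positivity
  have h4 : 0 < (k:ℝ) + 1 := by positivity
  have h5 : hc a b c (k+1) = (a + k) * (b + k) / (((k:ℝ) + 1) * (c + k)) * hc a b c k := by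
    field_simp
    linarith
  rw [h5, pow_succ]
  simp only [norm_mul, norm_div, Real.norm_eq_abs, abs_of_pos h2, abs_of_pos h4]
  calc _ = (|a + k| * |b + k| / (((k:ℝ)+1) * (c + k)) * |x|) * (|hc a b c k| * ‖x ^ k‖) := by
        simp only [Real.norm_eq_abs]; ring
    _ ≤ _ := by gcongr; simp

lemma ps_bound {c : ℕ → ℝ} (hs : ∀ x : ℝ, |x| < 1 → Summable (fun k => c k * x ^ k))
    {ρ : ℝ} (h0 : 0 ≤ ρ) (h1 : ρ < 1) :
    ∃ u : ℕ → ℝ, Summable u ∧ ∀ k : ℕ, ∀ y : ℝ, |y| ≤ ρ → ‖((k:ℝ)+1) * c (k+1) * y ^ k‖ ≤ u k := by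
  obtain ⟨r, hr1, hr2⟩ := exists_between h1
  have hr0 : 0 < r := h0.trans_lt hr1
  have hsr := hs r (by rwa [abs_of_pos hr0])
  obtain ⟨M, hM⟩ := hsr.tendsto_atTop_zero.norm.bddAbove_range
  have hM' : ∀ k, |c k| * r ^ k ≤ M := by
    intro k
    have := hM ⟨k, rfl⟩
    simpa [abs_of_pos hr0] using this
  refine ⟨fun k => M / r * ((k:ℝ) * (ρ/r)^k + (ρ / r)^k), ?_, ?_⟩
  · apply Summable.mul_left
    have hq : ‖ρ / r‖ < 1 := by
      rw [Real.norm_eq_abs, abs_of_nonneg (by positivity), div_lt_one hr0]; exact hr1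
    apply Summable.add
    · simpa using summable_pow_mul_geometric_of_norm_lt_one 1 hq
    · exact summable_geometric_of_norm_lt_one hq
  · intro k y hy
    have h2 : |c (k+1)| ≤ M / r / r ^ k := by
      rw [div_div, le_div_iff₀ (by positivity), ← pow_succ']
      exact hM' _
    have h3 : (0:ℝ) ≤ (k:ℝ) + 1 := by positivity
    have h5 : 0 ≤ M / r / r ^ k := (abs_nonneg _).trans h2
    rw [norm_mul, norm_mul, norm_pow]
    simp only [Real.norm_eq_abs]
    rw [abs_of_nonneg h3]
    calc _ ≤ ((k:ℝ) + 1) * (M / r / r ^ k) * ρ ^ k :=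
          mul_le_mul (mul_le_mul_of_nonneg_left h2 h3) (pow_le_pow_left₀ (abs_nonneg y) hy k)
            (by positivity) (mul_nonneg h3 h5)
      _ = _ := by rw [div_pow]; ring

lemma ps_summable_deriv {c : ℕ → ℝ} (hs : ∀ x : ℝ, |x| < 1 → Summable (fun k => c k * x ^ k))
    (x : ℝ) (hx : |x| < 1) : Summable (fun k : ℕ => ((k:ℝ)+1) * c (k+1) * x ^ k) := by
  obtain ⟨u, hu, hu'⟩ := ps_bound hs (abs_nonneg x) hx
  exact Summable.of_norm_bounded hu (fun k => hu' k x le_rfl)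

lemma ps_hasDerivAt {c : ℕ → ℝ} (hs : ∀ x : ℝ, |x| < 1 → Summable (fun k => c k * x ^ k))
    (x : ℝ) (hx : |x| < 1) : HasDerivAt (fun y => ∑' k : ℕ, c k * y ^ k)
      (∑' k : ℕ, ((k:ℝ)+1) * c (k+1) * x ^ k) x := by
  obtain ⟨ρ, hρ1, hρ2⟩ := exists_between hx
  have hρ0 : 0 < ρ := (abs_nonneg x).trans_lt hρ1
  obtain ⟨u, hu, hu'⟩ := ps_bound hs hρ0.le hρ2
  have hd := hasDerivAt_tsum_of_isPreconnected (g := fun k y => c (k+1) * y ^ (k+1))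
    (g' := fun k y => ((k:ℝ)+1) * c (k+1) * y ^ k) (t := Set.Ioo (-ρ) ρ) (y₀ := 0) (y := x)
    hu isOpen_Ioo isPreconnected_Ioo ?_ ?_ (by constructor <;> linarith) ?_ (abs_lt.mp hρ1)
  · have h2 := hd.const_add (c 0)
    refine h2.congr_of_eventuallyEq ?_
    have : Set.Ioo (-ρ) ρ ∈ 𝓝 x := isOpen_Ioo.mem_nhds (abs_lt.mp hρ1)
    filter_upwards [this] with y hy
    rw [(hs y ((abs_lt.mpr hy).trans hρ2)).tsum_eq_zero_add]
    simp
  · intro k y _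
    have := (hasDerivAt_pow (k+1) y).const_mul (c (k+1))
    refine this.congr_deriv ?_
    rw [Nat.add_sub_cancel]
    push_cast
    ring
  · intro k y hy
    exact hu' k y (abs_lt.mpr hy).le
  · simp [summable_zero]

/-- sum of hypergeometric series -/
noncomputable def hF (a b c x : ℝ) : ℝ := ∑' k : ℕ, hc a b c k * x ^ k

lemma hF_zero (a b c : ℝ) : hF a b c 0 = 1 := by
  rw [hF, tsum_eq_single 0]
  · simp [hc_zero]
  · intro k hk; simp [hk]

lemma rG_eq (lam nu x : ℝ) : rG lam nu x = hF (-nu) (nu + 2*lam) (lam + 1/2) ((1-x)/2) := rfl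

lemma ps_hasDerivAt2 {c : ℕ → ℝ} (hs : ∀ x : ℝ, |x| < 1 → Summable (fun k => c k * x ^ k))
    (x : ℝ) (hx : |x| < 1) : HasDerivAt (fun y => ∑' k : ℕ, ((k:ℝ)+1) * c (k+1) * y ^ k)
      (∑' k : ℕ, ((k:ℝ)+1) * (((k:ℝ)+2) * c (k+2)) * x ^ k) x := by
  have := ps_hasDerivAt (c := fun k : ℕ => ((k:ℝ)+1) * c (k+1)) (ps_summable_deriv hs) x hx
  convert this using 5
  push_cast; ring

/-- binomial series -/
lemma binom_sum (s x : ℝ) (hx : |x| < 1) : hF (-s) 1 1 x = (1 - x) ^ s := by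
  have hs := fun x hx => hc_summable (-s) 1 one_pos x hx
  have hd : ∀ y ∈ Set.Ioo (-1:ℝ) 1, HasDerivAt (fun y => hF (-s) 1 1 y * (1 - y) ^ (-s)) 0 y := by
    intro y hy
    have hy' : |y| < 1 := abs_lt.mpr hy
    have h1 := ps_hasDerivAt hs y hy'
    have hpos : 0 < 1 - y := by linarith [hy.2]
    have h2 : HasDerivAt (fun y : ℝ => (1 - y) ^ (-s)) (-1 * (-s) * (1 - y) ^ (-s - 1)) y :=
      HasDerivAt.rpow_const ((hasDerivAt_id y).const_sub 1) (Or.inl hpos.ne')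
    have h3 := h1.mul h2
    refine h3.congr_deriv ?_
    have hode : (1 - y) * (∑' k : ℕ, ((k:ℝ)+1) * hc (-s) 1 1 (k+1) * y ^ k) =
        - s * ∑' k : ℕ, hc (-s) 1 1 k * y ^ k := by
      have hsd := ps_summable_deriv hs y hy'
      have e1 : y * (∑' k : ℕ, ((k:ℝ)+1) * hc (-s) 1 1 (k+1) * y ^ k) =
          ∑' k : ℕ, (k:ℝ) * hc (-s) 1 1 k * y ^ k := by
        have hk : Summable (fun k : ℕ => (k:ℝ) * hc (-s) 1 1 k * y ^ k) := by
          rw [← summable_nat_add_iff 1]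
          refine (hsd.mul_left y).congr ?_
          intro k; push_cast; ring
        rw [hk.tsum_eq_zero_add, ← tsum_mul_left]
        simp only [Nat.cast_zero, zero_mul, zero_add]
        congr 1; ext k; push_cast; ring
      have hk : Summable (fun k : ℕ => (k:ℝ) * hc (-s) 1 1 k * y ^ k) := by
        rw [← summable_nat_add_iff 1]
        refine (hsd.mul_left y).congr ?_
        intro k; push_cast; ring
      rw [sub_mul, one_mul, e1, ← hsd.tsum_sub hk, ← tsum_mul_left]
      congr 1; ext k
      have := hc_succ (-s) 1 one_pos k
      have h4 : (k:ℝ) + 1 ≠ 0 := by positivity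
      have h5 : ((k:ℝ) + 1) * hc (-s) 1 1 (k+1) = (-s + k) * hc (-s) 1 1 k := by
        apply mul_left_cancel₀ h4
        linear_combination this
      rw [h5]; ring
    have h6 : (1 - y) ^ (-s) = (1 - y) ^ (-s - 1) * (1 - y) := by
      rw [← Real.rpow_add_one hpos.ne']; congr 1; ring
    rw [h6]
    linear_combination (1 - y) ^ (-s - 1) * hode
  have hconst : hF (-s) 1 1 x * (1 - x) ^ (-s) = hF (-s) 1 1 0 * (1 - 0) ^ (-s) := by
    apply (convex_Ioo (-1:ℝ) 1).is_const_of_fderivWithin_eq_zero (𝕜 := ℝ)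
      (f := fun y => hF (-s) 1 1 y * (1 - y) ^ (-s))
    · intro y hy; exact (hd y hy).differentiableAt.differentiableWithinAt
    · intro y hy
      rw [fderivWithin_of_isOpen isOpen_Ioo hy]
      have := (hd y hy).hasFDerivAt.fderiv
      rw [this]; ext; simp
    · exact abs_lt.mp hx
    · norm_num
  have hpos : 0 < 1 - x := by linarith [(abs_lt.mp hx).2]
  rw [hF_zero, sub_zero, Real.one_rpow, one_mul, Real.rpow_neg hpos.le] at hconst
  have : (1 - x) ^ s ≠ 0 := (Real.rpow_pos_of_pos hpos s).ne'
  field_simp at hconst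
  exact hconst

section Formal
open PowerSeries

lemma formal_ode_iff (a b c : ℝ) (y : PowerSeries ℝ) (n : ℕ) :
    coeff n (X * derivative ℝ (derivative ℝ y) - X * (X * derivative ℝ (derivative ℝ y)) +
      C c * derivative ℝ y - C (a + b + 1) * (X * derivative ℝ y) - C (a * b) * y) =
    ((n:ℝ) + 1) * (c + n) * coeff (n+1) y - (a + n) * (b + n) * coeff n y := by
  obtain ⟨p, hp⟩ : ∃ p, p = a + b + 1 := ⟨_, rfl⟩
  obtain ⟨q, hq⟩ : ∃ q, q = a * b := ⟨_, rfl⟩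
  rw [← hp, ← hq]
  rcases n with _ | _ | n
  · simp only [map_sub, map_add, coeff_C_mul, coeff_zero_X_mul, coeff_derivative]
    push_cast; rw [hq]; ring
  · have h : coeff 1 (X * (X * derivative ℝ (derivative ℝ y))) = 0 := by
      rw [show (1:ℕ) = 0 + 1 from rfl, coeff_succ_X_mul, coeff_zero_X_mul]
    simp only [zero_add, map_sub, map_add, coeff_C_mul, h]
    have h2 : ∀ f : PowerSeries ℝ, coeff 1 (X * f) = coeff 0 f := fun f => by
      rw [show (1:ℕ) = 0 + 1 from rfl, coeff_succ_X_mul]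
    simp only [h2, coeff_derivative]
    push_cast; rw [hp, hq]; ring
  · simp only [map_sub, map_add, coeff_C_mul, coeff_succ_X_mul, coeff_derivative]
    push_cast; rw [hp, hq]; ring

lemma formal_ode (a b : ℝ) {c : ℝ} (h0 : 0 < c) (y : PowerSeries ℝ) (hy : y = mk (hc a b c)) :
    X * derivative ℝ (derivative ℝ y) - X * (X * derivative ℝ (derivative ℝ y)) +
      C c * derivative ℝ y - C (a + b + 1) * (X * derivative ℝ y) - C (a * b) * y = 0 := by
  ext n
  rw [formal_ode_iff, hy, coeff_mk, coeff_mk, hc_succ a b h0 n]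
  simp

lemma formal_unique (a b : ℝ) {c : ℝ} (h0 : 0 < c) (y : PowerSeries ℝ) (hy0 : coeff 0 y = 1)
    (hy : X * derivative ℝ (derivative ℝ y) - X * (X * derivative ℝ (derivative ℝ y)) +
      C c * derivative ℝ y - C (a + b + 1) * (X * derivative ℝ y) - C (a * b) * y = 0) (n : ℕ) :
    coeff n y = hc a b c n := by
  induction n with
  | zero => rw [hy0, hc_zero]
  | succ n ih =>
    have h1 := formal_ode_iff a b c y n
    rw [hy] at h1
    have h2 := hc_succ a b h0 n
    have h3 : ((n:ℝ) + 1) * (c + n) ≠ 0 := by positivity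
    apply mul_left_cancel₀ h3
    rw [h2, ← ih]
    simp only [map_zero] at h1
    linarith

lemma formal_binom (s : ℝ) (y : PowerSeries ℝ) (hy : y = mk (hc (-s) 1 1)) :
    (1 - X) * derivative ℝ y = - (C s * y) := by
  ext n
  have key : ∀ n : ℕ, ((n:ℝ) + 1) * hc (-s) 1 1 (n+1) = (-s + n) * hc (-s) 1 1 n := by
    intro n
    have h := hc_succ (-s) 1 one_pos n
    have h4 : (n:ℝ) + 1 ≠ 0 := by positivity
    apply mul_left_cancel₀ h4
    linear_combination h
  rw [sub_mul, one_mul, hy]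
  rcases n with _ | n
  · simp only [map_sub, map_neg, coeff_zero_X_mul, coeff_derivative, coeff_mk, coeff_C_mul]
    have := key 0
    push_cast at *
    linarith
  · simp only [map_sub, map_neg, coeff_succ_X_mul, coeff_derivative, coeff_mk, coeff_C_mul]
    have := key (n+1)
    push_cast at *
    linarith

lemma formal_euler (α β : ℝ) {c : ℝ} (h0 : 0 < c) (n : ℕ) :
    coeff n ((mk (hc (-(α + β - c)) 1 1) : PowerSeries ℝ) * mk (hc α β c)) =
      hc (c - α) (c - β) c n := by
  obtain ⟨B, hB⟩ : ∃ B : PowerSeries ℝ, B = mk (hc (-(α + β - c)) 1 1) := ⟨_, rfl⟩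
  obtain ⟨Q, hQ⟩ : ∃ Q : PowerSeries ℝ, Q = mk (hc α β c) := ⟨_, rfl⟩
  rw [← hB, ← hQ]
  apply formal_unique _ _ h0
  · rw [hB, hQ]
    simp [coeff_mul, hc_zero]
  have b1 := formal_binom _ B hB
  have q1 := formal_ode α β h0 Q hQ
  have b2 := congrArg (derivative ℝ) b1
  have hD1 : derivative ℝ (1 - X : PowerSeries ℝ) = -1 := by simp
  have hDC : ∀ (r : ℝ) (f : PowerSeries ℝ), derivative ℝ (C r * f) = C r * derivative ℝ f := by
    intro r f; rw [Derivation.leibniz]; simp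
  rw [Derivation.leibniz, hD1, map_neg, hDC] at b2
  have e1 : derivative ℝ (B * Q) = B * derivative ℝ Q + derivative ℝ B * Q := by
    rw [Derivation.leibniz]; simp [mul_comm]
  have e2 : derivative ℝ (derivative ℝ (B * Q)) = B * derivative ℝ (derivative ℝ Q) +
      2 * (derivative ℝ B * derivative ℝ Q) + derivative ℝ (derivative ℝ B) * Q := by
    rw [e1, map_add, Derivation.leibniz, Derivation.leibniz]
    simp only [smul_eq_mul]; ring
  rw [e2, e1]
  have hne : (1 - X : PowerSeries ℝ) ≠ 0 := by
    intro h
    have := congrArg (coeff 0) h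
    simp at this
  apply mul_left_cancel₀ hne
  rw [mul_zero]
  simp only [smul_eq_mul, map_sub, map_add, map_mul, map_one] at *
  generalize derivative ℝ (derivative ℝ B) = B2 at *
  generalize derivative ℝ (derivative ℝ Q) = Q2 at *
  generalize derivative ℝ B = B1 at *
  generalize derivative ℝ Q = Q1 at *
  clear hB hQ e1 e2 hD1 hDC
  generalize (C α : PowerSeries ℝ) = A at *
  generalize (C β : PowerSeries ℝ) = E at *
  generalize (C c : PowerSeries ℝ) = K at *
  have b2' : (1 - X) * B2 = B1 - (A + E - K) * B1 := by linear_combination b2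
  linear_combination (X * Q * (1 - X)) * b2' + ((1 - X) * B) * q1 +
    (2 * X * (1 - X) * Q1 + X * (1 - (A + E - K)) * Q +
      (K - (K - A + (K - E) + 1) * X) * Q) * b1
end Formal

lemma euler_transform (α β : ℝ) {c : ℝ} (h0 : 0 < c) (x : ℝ) (hx : |x| < 1) :
    hF (c - α) (c - β) c x = (1 - x) ^ (α + β - c) * hF α β c x := by
  rw [← binom_sum _ _ hx, hF, hF, hF]
  have s1 := (hc_summable (-(α + β - c)) 1 one_pos x hx)
  have s2 := (hc_summable α β h0 x hx)
  rw [tsum_mul_tsum_eq_tsum_sum_antidiagonal_of_summable_norm s1.norm s2.norm]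
  congr 1; ext n
  rw [← formal_euler α β h0 n, PowerSeries.coeff_mul, Finset.sum_mul]
  apply Finset.sum_congr rfl
  intro p hp
  rw [PowerSeries.coeff_mk, PowerSeries.coeff_mk, ← Finset.HasAntidiagonal.mem_antidiagonal.mp hp, pow_add]
  ring

/-- hypergeometric ODE in the case needed -/
lemma cos_ode (N x : ℝ) (hx : |x| < 1) :
    x * (1 - x) * (∑' k : ℕ, ((k:ℝ)+1) * (((k:ℝ)+2) * hc (-N) N (1/2) (k+2)) * x ^ k) +
      (1/2 - x) * (∑' k : ℕ, ((k:ℝ)+1) * hc (-N) N (1/2) (k+1) * x ^ k) +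
      N ^ 2 * (∑' k : ℕ, hc (-N) N (1/2) k * x ^ k) = 0 := by
  set c := hc (-N) N (1/2) with hcdef
  have hs := fun x hx => hc_summable (-N) N (c := 1/2) (by norm_num) x hx
  have s0 := hs x hx
  have s1 := ps_summable_deriv hs x hx
  have s2 : Summable (fun k : ℕ => ((k:ℝ)+1) * (((k:ℝ)+2) * c (k+2)) * x ^ k) := by
    refine (ps_summable_deriv (ps_summable_deriv hs) x hx).congr ?_
    intro k; push_cast; ring
  have t1 : Summable (fun k : ℕ => (k:ℝ) * c k * x ^ k) := by
    rw [← summable_nat_add_iff 1]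
    refine (s1.mul_left x).congr ?_
    intro k; push_cast; ring
  have e1 : x * (∑' k : ℕ, ((k:ℝ)+1) * c (k+1) * x ^ k) = ∑' k : ℕ, (k:ℝ) * c k * x ^ k := by
    rw [t1.tsum_eq_zero_add, ← tsum_mul_left]
    simp only [Nat.cast_zero, zero_mul, zero_add]
    congr 1; ext k; push_cast; ring
  have t2 : Summable (fun k : ℕ => (k:ℝ) * (((k:ℝ)+1) * c (k+1)) * x ^ k) := by
    rw [← summable_nat_add_iff 1]
    refine (s2.mul_left x).congr ?_
    intro k; push_cast; ring
  have e2 : x * (∑' k : ℕ, ((k:ℝ)+1) * (((k:ℝ)+2) * c (k+2)) * x ^ k) =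
      ∑' k : ℕ, (k:ℝ) * (((k:ℝ)+1) * c (k+1)) * x ^ k := by
    rw [t2.tsum_eq_zero_add, ← tsum_mul_left]
    simp only [Nat.cast_zero, zero_mul, zero_add]
    congr 1; ext k; push_cast; ring
  have t3 : Summable (fun k : ℕ => (k:ℝ) * ((k:ℝ) - 1) * c k * x ^ k) := by
    rw [← summable_nat_add_iff 1]
    refine (t2.mul_left x).congr ?_
    intro k; push_cast; ring
  have e3 : x * (∑' k : ℕ, (k:ℝ) * (((k:ℝ)+1) * c (k+1)) * x ^ k) =
      ∑' k : ℕ, (k:ℝ) * ((k:ℝ) - 1) * c k * x ^ k := by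
    rw [t3.tsum_eq_zero_add, ← tsum_mul_left]
    simp only [Nat.cast_zero, zero_mul, zero_add]
    congr 1; ext k; push_cast; ring
  have : (∑' k : ℕ, (k:ℝ) * (((k:ℝ)+1) * c (k+1)) * x ^ k) -
      (∑' k : ℕ, (k:ℝ) * ((k:ℝ) - 1) * c k * x ^ k) +
      (1/2) * (∑' k : ℕ, ((k:ℝ)+1) * c (k+1) * x ^ k) - (∑' k : ℕ, (k:ℝ) * c k * x ^ k) +
      N ^ 2 * (∑' k : ℕ, c k * x ^ k) = 0 := by
    rw [← t2.tsum_sub t3, ← tsum_mul_left, ← tsum_mul_left,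
      ← (t2.sub t3).tsum_add (s1.mul_left (1/2)), 
      ← ((t2.sub t3).add (s1.mul_left (1/2))).tsum_sub t1,
      ← (((t2.sub t3).add (s1.mul_left (1/2))).sub t1).tsum_add (s0.mul_left _)]
    rw [← tsum_zero (α := ℝ) (β := ℕ)]
    congr 1; ext k
    have := hc_succ (-N) N (c := 1/2) (by norm_num) k
    rw [← hcdef] at this
    linear_combination x ^ k * this
  linear_combination this + (1 - x) * e2 - e3 - e1

lemma cos_eq_hF (N θ : ℝ) (h0 : 0 ≤ θ) (hπ : θ < π) :
    Real.cos (N * θ) = hF (-N) N (1/2) (Real.sin (θ/2) ^ 2) := by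
  set c := hc (-N) N (1/2) with hcdef
  have hs : ∀ x : ℝ, |x| < 1 → Summable (fun k => c k * x ^ k) :=
    fun x hx => hc_summable (-N) N (c := 1/2) (by norm_num) x hx
  have hsin : ∀ t ∈ Set.Ioo (-π) π, |Real.sin (t/2) ^ 2| < 1 := by
    intro t ht
    have : 0 < Real.cos (t/2) := Real.cos_pos_of_mem_Ioo ⟨by linarith [ht.1], by linarith [ht.2]⟩
    rw [abs_of_nonneg (sq_nonneg _), Real.sin_sq]
    nlinarith
  set h : ℝ → ℝ := fun x => ∑' k : ℕ, c k * x ^ k with hh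
  set h1 : ℝ → ℝ := fun x => ∑' k : ℕ, ((k:ℝ)+1) * c (k+1) * x ^ k with hh1
  set h2 : ℝ → ℝ := fun x => ∑' k : ℕ, ((k:ℝ)+1) * (((k:ℝ)+2) * c (k+2)) * x ^ k with hh2
  have du : ∀ t : ℝ, HasDerivAt (fun t => Real.sin (t/2) ^ 2) (Real.sin t / 2) t := by
    intro t
    have := ((Real.hasDerivAt_sin (t/2)).comp t ((hasDerivAt_id t).div_const 2)).pow 2
    refine this.congr_deriv ?_
    have e : Real.sin t = 2 * Real.sin (t/2) * Real.cos (t/2) := by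
      rw [← Real.sin_two_mul]; congr 1; ring
    rw [e]
    simp only [Function.comp_apply, id_eq]
    ring
  have dh : ∀ t ∈ Set.Ioo (-π) π, HasDerivAt (fun t => h (Real.sin (t/2) ^ 2))
      (h1 (Real.sin (t/2) ^ 2) * (Real.sin t / 2)) t := fun t ht =>
    HasDerivAt.comp t (ps_hasDerivAt hs _ (hsin t ht)) (du t)
  have dh1 : ∀ t ∈ Set.Ioo (-π) π, HasDerivAt (fun t => h1 (Real.sin (t/2) ^ 2))
      (h2 (Real.sin (t/2) ^ 2) * (Real.sin t / 2)) t := fun t ht =>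
    HasDerivAt.comp t (ps_hasDerivAt2 hs _ (hsin t ht)) (du t)
  have dcos : ∀ t : ℝ, HasDerivAt (fun t => Real.cos (N*t)) (- Real.sin (N * t) * N) t := by
    intro t
    have := (Real.hasDerivAt_cos (N*t)).comp t ((hasDerivAt_id t).const_mul N)
    refine this.congr_deriv (by ring)
  have dsin : ∀ t : ℝ, HasDerivAt (fun t => Real.sin (N*t)) (Real.cos (N * t) * N) t := by
    intro t
    have := (Real.hasDerivAt_sin (N*t)).comp t ((hasDerivAt_id t).const_mul N)
    refine this.congr_deriv (by ring)
  -- rotation: conserved quantities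
  set S : ℝ → ℝ := fun t => h (Real.sin (t/2) ^ 2) with hS
  set S1 : ℝ → ℝ := fun t => h1 (Real.sin (t/2) ^ 2) * (Real.sin t / 2) with hS1
  have dS1 : ∀ t ∈ Set.Ioo (-π) π, HasDerivAt S1 (- N^2 * S t) t := by
    intro t ht
    have := (dh1 t ht).mul ((Real.hasDerivAt_sin t).div_const 2)
    refine this.congr_deriv ?_
    have ode := cos_ode N (Real.sin (t/2) ^ 2) (hsin t ht)
    have e : Real.sin t = 2 * Real.sin (t/2) * Real.cos (t/2) := by
      rw [← Real.sin_two_mul]; congr 1; ring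
    have e' : Real.cos t = 1 - 2 * Real.sin (t/2) ^ 2 := by
      have := Real.cos_sq' (t/2)
      have h5 : Real.cos t = 2 * Real.cos (t/2) ^ 2 - 1 := by
        rw [← Real.cos_two_mul]; congr 1; ring
      rw [h5, this]; ring
    have e2 : Real.cos (t/2) ^ 2 = 1 - Real.sin (t/2) ^ 2 := Real.cos_sq' _
    change _ = -N^2 * h (Real.sin (t/2) ^ 2)
    change Real.sin (t/2) ^ 2 * (1 - Real.sin (t/2) ^ 2) * h2 (Real.sin (t/2) ^ 2) +
      (1/2 - Real.sin (t/2) ^ 2) * h1 (Real.sin (t/2) ^ 2) +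
      N ^ 2 * h (Real.sin (t/2) ^ 2) = 0 at ode
    rw [e, e']
    linear_combination ode + h2 (Real.sin (t/2) ^ 2) * Real.sin (t/2)^2 * e2
  -- energy of the difference
  have dE : ∀ t ∈ Set.Ioo (-π) π, HasDerivAt (fun t => (S1 t + N * Real.sin (N*t))^2 +
      N^2 * (S t - Real.cos (N*t))^2) 0 t := by
    intro t ht
    have a1 := ((dS1 t ht).add ((dsin t).const_mul N)).pow 2
    have a2 := (((dh t ht).sub (dcos t)).pow 2).const_mul (N^2)
    refine (a1.add a2).congr_deriv ?_
    simp only [Pi.add_apply, Pi.sub_apply, hS, hS1]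
    push_cast
    ring
  have hconst : ∀ t ∈ Set.Ioo (-π) π, (S1 t + N * Real.sin (N*t))^2 +
      N^2 * (S t - Real.cos (N*t))^2 = 0 := by
    intro t ht
    have := (convex_Ioo (-π) π).is_const_of_fderivWithin_eq_zero (𝕜 := ℝ)
      (f := fun t => (S1 t + N * Real.sin (N*t))^2 +
      N^2 * (S t - Real.cos (N*t))^2) (x := t) (y := 0)
      (fun y hy => (dE y hy).differentiableAt.differentiableWithinAt)
      (fun y hy => by
        rw [fderivWithin_of_isOpen isOpen_Ioo hy]
        have := (dE y hy).hasFDerivAt.fderiv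
        rw [this]; ext; simp) ht ⟨by linarith [Real.pi_pos], Real.pi_pos⟩
    rw [this]
    have hS0 : S 0 = 1 := by
      have e : Real.sin ((0:ℝ)/2) ^ 2 = 0 := by simp
      change hF (-N) N (1/2) (Real.sin ((0:ℝ)/2) ^ 2) = 1
      rw [e, hF_zero]
    rw [hS0]
    simp [hS1]
  have hmem : θ ∈ Set.Ioo (-π) π := ⟨by linarith [Real.pi_pos], hπ⟩
  -- derivative of the difference vanishes
  have hS1e : ∀ t ∈ Set.Ioo (-π) π, S1 t = - Real.sin (N*t) * N := by
    intro t ht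
    have := hconst t ht
    have h3 : (S1 t + N * Real.sin (N*t))^2 = 0 := by
      nlinarith [sq_nonneg (S1 t + N * Real.sin (N*t)), sq_nonneg (N * (S t - Real.cos (N*t)))]
    have := pow_eq_zero_iff (two_ne_zero) |>.mp h3
    linarith
  have hfin := (convex_Ioo (-π) π).is_const_of_fderivWithin_eq_zero (𝕜 := ℝ)
      (f := fun t => S t - Real.cos (N*t)) (x := θ) (y := 0)
      (fun y hy => ((dh y hy).sub (dcos y)).differentiableAt.differentiableWithinAt)
      (fun y hy => by
        rw [fderivWithin_of_isOpen isOpen_Ioo hy]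
        have := ((dh y hy).sub (dcos y)).hasFDerivAt.fderiv
        have h4 := hS1e y hy
        simp only [hS1] at h4
        rw [h4, sub_self] at this
        change fderiv ℝ (fun t => S t - Real.cos (N*t)) y = _ at this
        rw [this]; ext; simp) hmem ⟨by linarith [Real.pi_pos], Real.pi_pos⟩
  have hS0 : S 0 = 1 := by
    have e : Real.sin ((0:ℝ)/2) ^ 2 = 0 := by simp
    change hF (-N) N (1/2) (Real.sin ((0:ℝ)/2) ^ 2) = 1
    rw [e, hF_zero]
  simp only [hS0, mul_zero, Real.cos_zero, sub_self] at hfin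
  change Real.cos (N * θ) = S θ
  linarith

lemma beta_int {p q : ℝ} (hp : 0 < p) (hq : 0 < q) :
    IntegrableOn (fun v : ℝ => v ^ (p - 1) * (1 - v) ^ (q - 1)) (Set.Ioo 0 1) ∧
    ∫ v in Set.Ioo (0:ℝ) 1, v ^ (p - 1) * (1 - v) ^ (q - 1) =
      Real.Gamma p * Real.Gamma q / Real.Gamma (p + q) := by
  have hconv := Complex.betaIntegral_convergent (u := p) (v := q) (by simpa) (by simpa)
  have hval := Complex.betaIntegral_eq_Gamma_mul_div (p:ℂ) q (by simpa) (by simpa)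
  rw [intervalIntegrable_iff_integrableOn_Ioo_of_le zero_le_one] at hconv
  rw [Complex.betaIntegral, intervalIntegral.integral_of_le zero_le_one,
    integral_Ioc_eq_integral_Ioo] at hval
  have heq : ∀ v ∈ Set.Ioo (0:ℝ) 1, (v:ℂ) ^ ((p:ℂ) - 1) * (1 - (v:ℂ)) ^ ((q:ℂ) - 1) =
      ((v ^ (p - 1) * (1 - v) ^ (q - 1) : ℝ) : ℂ) := by
    intro v hv
    have h1 : 0 ≤ 1 - v := by linarith [hv.2]
    rw [Complex.ofReal_mul, Complex.ofReal_cpow hv.1.le, Complex.ofReal_cpow h1]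
    push_cast; rfl
  rw [setIntegral_congr_fun measurableSet_Ioo heq, integral_complex_ofReal] at hval
  have h2 := (integrableOn_congr_fun heq measurableSet_Ioo).mp hconv
  refine ⟨?_, ?_⟩
  · have := h2.re
    simpa [IntegrableOn] using this
  · rw [Complex.Gamma_ofReal, Complex.Gamma_ofReal, ← Complex.ofReal_add,
      Complex.Gamma_ofReal] at hval
    exact_mod_cast hval

lemma Gamma_add_nat {a : ℝ} (ha : 0 < a) (k : ℕ) :
    Real.Gamma (a + k) = poch a k * Real.Gamma a := by
  induction k with
  | zero => simp [poch_zero]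
  | succ k ih =>
    push_cast
    rw [← add_assoc, Real.Gamma_add_one (by positivity), ih, poch_succ]; ring

lemma hF_beta (α β : ℝ) {lam a : ℝ} (hl : 0 < lam) (ha0 : 0 < a) (ha1 : a < 1) :
    ∫ v in Set.Ioo (0:ℝ) 1, hF α β (1/2) (a * v) * (v ^ ((1/2:ℝ) - 1) * (1 - v) ^ (lam - 1)) =
      Real.sqrt π * Real.Gamma lam / Real.Gamma (lam + 1/2) * hF α β (lam + 1/2) a := by
  have hint := fun k : ℕ => beta_int (p := 1/2 + k) (q := lam) (by positivity) hl
  have hB : ∀ k : ℕ, hc α β (1/2) k * (Real.Gamma (1/2 + k) * Real.Gamma lam /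
      Real.Gamma (1/2 + k + lam)) =
      Real.sqrt π * Real.Gamma lam / Real.Gamma (lam + 1/2) * hc α β (lam + 1/2) k := by
    intro k
    rw [show 1/2 + (k:ℝ) + lam = (lam + 1/2) + k by ring, Gamma_add_nat (by norm_num),
      Gamma_add_nat (by positivity), Real.Gamma_one_half_eq, hc, hc]
    have h1 := (poch_pos (show (0:ℝ) < 1/2 by norm_num) k).ne'
    have h2 := (poch_pos (show (0:ℝ) < lam + 1/2 by positivity) k).ne'
    have h3 := (Real.Gamma_pos_of_pos (show (0:ℝ) < lam + 1/2 by positivity)).ne'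
    have h4 : (k.factorial : ℝ) ≠ 0 := by positivity
    field_simp
  set F : ℕ → ℝ → ℝ := fun k v => hc α β (1/2) k * a ^ k *
    (v ^ ((1/2 + k : ℝ) - 1) * (1 - v) ^ (lam - 1)) with hF'
  have hFi : ∀ k, Integrable (F k) (volume.restrict (Set.Ioo 0 1)) := fun k =>
    (hint k).1.const_mul _
  have hnorm : ∀ k, ∫ v in Set.Ioo (0:ℝ) 1, ‖F k v‖ =
      ‖Real.sqrt π * Real.Gamma lam / Real.Gamma (lam + 1/2) * (hc α β (lam + 1/2) k * a ^ k)‖ := by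
    intro k
    have e : ∀ v ∈ Set.Ioo (0:ℝ) 1, ‖F k v‖ = ‖hc α β (1/2) k * a ^ k‖ *
        (v ^ ((1/2 + k : ℝ) - 1) * (1 - v) ^ (lam - 1)) := by
      intro v hv
      simp only [hF']
      rw [norm_mul]
      congr 1
      rw [Real.norm_of_nonneg]
      have h1 : 0 ≤ 1 - v := by linarith [hv.2]
      have h2 := hv.1.le
      positivity
    rw [setIntegral_congr_fun measurableSet_Ioo e, integral_const_mul, (hint k).2]
    rw [show Real.sqrt π * Real.Gamma lam / Real.Gamma (lam + 1/2) *
      (hc α β (lam + 1/2) k * a ^ k) = a ^ k * (Real.sqrt π * Real.Gamma lam /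
        Real.Gamma (lam + 1/2) * hc α β (lam + 1/2) k) by ring, ← hB k]
    have hpos : 0 < Real.Gamma (1/2 + k) * Real.Gamma lam / Real.Gamma (1/2 + k + lam) := by
      have h1 := Real.Gamma_pos_of_pos (show (0:ℝ) < 1/2 + k by positivity)
      have h2 := Real.Gamma_pos_of_pos (show (0:ℝ) < 1/2 + k + lam by positivity)
      have h3 := Real.Gamma_pos_of_pos hl
      positivity
    rw [norm_mul, norm_mul, norm_mul, Real.norm_of_nonneg hpos.le]
    ring
  have hsum : Summable fun k => ∫ v in Set.Ioo (0:ℝ) 1, ‖F k v‖ := by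
    simp_rw [hnorm]
    exact ((hc_summable α β (c := lam + 1/2) (by positivity) a
      (by rwa [abs_of_pos ha0])).mul_left _).norm
  have key := hasSum_integral_of_summable_integral_norm hFi hsum
  have e1 : ∀ v ∈ Set.Ioo (0:ℝ) 1, ∑' k, F k v =
      hF α β (1/2) (a * v) * (v ^ ((1/2:ℝ) - 1) * (1 - v) ^ (lam - 1)) := by
    intro v hv
    rw [hF, ← tsum_mul_right]
    congr 1; ext k
    simp only [hF']
    rw [show (1/2 + k : ℝ) - 1 = (1/2 - 1) + k by ring, Real.rpow_add hv.1, Real.rpow_natCast,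
      mul_pow]
    ring
  rw [← setIntegral_congr_fun measurableSet_Ioo e1, ← key.tsum_eq, hF, ← tsum_mul_left]
  congr 1; ext k
  simp only [hF']
  rw [integral_const_mul, (hint k).2]
  linear_combination a ^ k * hB k

lemma sq_rpow' {x : ℝ} (hx : 0 < x) (r : ℝ) : (x ^ 2) ^ r = x ^ (2 * r) := by
  rw [Real.rpow_mul hx.le]; norm_num

/-- change of variables -/
lemma cov_image {φ : ℝ} (h0 : 0 < φ) (hπ : φ < π) :
    (fun θ => (1 - Real.cos θ) / (1 - Real.cos φ)) '' Set.Ioo 0 φ = Set.Ioo 0 1 := by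
  have hc1 : ∀ x y : ℝ, 0 ≤ x → y ≤ π → x < y → Real.cos y < Real.cos x := fun x y hx hy hxy =>
    Real.cos_lt_cos_of_nonneg_of_le_pi hx hy hxy
  have hpos : 0 < 1 - Real.cos φ := by
    have := hc1 0 φ le_rfl hπ.le h0
    rw [Real.cos_zero] at this; linarith
  apply Set.Subset.antisymm
  · rintro _ ⟨θ, hθ, rfl⟩
    have h1 := hc1 0 θ le_rfl (by linarith [hθ.2]) hθ.1
    have h2 := hc1 θ φ hθ.1.le hπ.le hθ.2
    rw [Real.cos_zero] at h1
    constructor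
    · simp only; apply div_pos <;> linarith
    · simp only; rw [div_lt_one hpos]; linarith
  · have := intermediate_value_Ioo (f := fun θ => (1 - Real.cos θ) / (1 - Real.cos φ)) h0.le
      (by fun_prop)
    simpa [div_self hpos.ne'] using this

lemma cov_inj {φ : ℝ} (hπ : φ < π) :
    Set.InjOn (fun θ => (1 - Real.cos θ) / (1 - Real.cos φ)) (Set.Ioo 0 φ) := by
  intro x hx y hy hxy
  have hpos : 0 < 1 - Real.cos φ := by
    have := Real.cos_lt_cos_of_nonneg_of_le_pi le_rfl hπ.le (hx.1.trans hx.2)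
    rw [Real.cos_zero] at this; linarith
  simp only at hxy
  rw [div_left_inj' hpos.ne'] at hxy
  apply Real.injOn_cos ⟨hx.1.le, by linarith [hx.2]⟩ ⟨hy.1.le, by linarith [hy.2]⟩
  linarith

lemma cov_deriv (φ : ℝ) : ∀ θ ∈ Set.Ioo 0 φ,
    HasDerivWithinAt (fun θ => (1 - Real.cos θ) / (1 - Real.cos φ))
      (Real.sin θ / (1 - Real.cos φ)) (Set.Ioo 0 φ) θ := by
  intro θ _
  have := ((Real.hasDerivAt_cos θ).const_sub 1).div_const (1 - Real.cos φ)
  simpa using this.hasDerivWithinAt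

/-- pointwise identity of the weight after the change of variables -/
lemma cov_weight {φ lam : ℝ} (h0 : 0 < φ) (hπ : φ < π) (θ : ℝ) (hθ : θ ∈ Set.Ioo 0 φ) :
    |Real.sin θ / (1 - Real.cos φ)| *
      (((1 - Real.cos θ) / (1 - Real.cos φ)) ^ ((1/2:ℝ) - 1) *
        (1 - (1 - Real.cos θ) / (1 - Real.cos φ)) ^ (lam - 1)) =
    (Real.sin (φ/2))⁻¹ * (2 * Real.sin (φ/2) ^ 2) ^ (1 - lam) *
      (Real.cos (θ/2) * (Real.cos θ - Real.cos φ) ^ (lam - 1)) := by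
  have hc1 : ∀ x : ℝ, 1 - Real.cos x = 2 * Real.sin (x/2) ^ 2 := by
    intro x
    have h5 : Real.cos x = 2 * Real.cos (x/2) ^ 2 - 1 := by
      rw [← Real.cos_two_mul]; congr 1; ring
    rw [h5, Real.cos_sq']; ring
  have hsφ : 0 < Real.sin (φ/2) := Real.sin_pos_of_pos_of_lt_pi (by linarith) (by linarith)
  have hsθ : 0 < Real.sin (θ/2) :=
    Real.sin_pos_of_pos_of_lt_pi (by linarith [hθ.1]) (by linarith [hθ.2])
  have hsθ' : 0 < Real.sin θ := Real.sin_pos_of_pos_of_lt_pi hθ.1 (by linarith [hθ.2])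
  have hlt := Real.cos_lt_cos_of_nonneg_of_le_pi hθ.1.le hπ.le hθ.2
  have hd : 0 < 1 - Real.cos φ := by rw [hc1]; positivity
  have e1 : 1 - (1 - Real.cos θ) / (1 - Real.cos φ) =
      (Real.cos θ - Real.cos φ) / (1 - Real.cos φ) := by field_simp; ring
  have e2 : ((1 - Real.cos θ) / (1 - Real.cos φ)) ^ ((1/2:ℝ) - 1) =
      Real.sin (φ/2) / Real.sin (θ/2) := by
    rw [hc1, hc1, mul_div_mul_left _ _ two_ne_zero, ← div_pow, ← Real.rpow_natCast,
      ← Real.rpow_mul (by positivity)]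
    norm_num
    rw [Real.rpow_neg_one, inv_div]
  have e3 : Real.sin θ = 2 * Real.sin (θ/2) * Real.cos (θ/2) := by
    rw [← Real.sin_two_mul]; congr 1; ring
  rw [abs_of_pos (by positivity), e1, e2, Real.div_rpow (by linarith) hd.le, e3,
    show (1 - lam) = -(lam - 1) by ring, ← hc1, Real.rpow_neg hd.le]
  have h7 : (1 - Real.cos φ) ^ (lam - 1) ≠ 0 := (Real.rpow_pos_of_pos hd _).ne'
  generalize (1 - Real.cos φ) ^ (lam - 1) = W at *
  rw [hc1]
  field_simp

lemma kernel_integrable {φ lam : ℝ} (hl : 0 < lam) (h0 : 0 < φ) (hπ : φ < π) :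
    IntegrableOn (fun θ => (Real.cos θ - Real.cos φ) ^ (lam - 1)) (Set.Ioo 0 φ) := by
  have hb := (beta_int (p := 1/2) (q := lam) (by norm_num) hl).1
  rw [← cov_image h0 hπ, integrableOn_image_iff_integrableOn_abs_deriv_smul measurableSet_Ioo
    (cov_deriv φ) (cov_inj hπ)] at hb
  simp only [smul_eq_mul] at hb
  have h2 := (integrableOn_congr_fun (cov_weight (lam := lam) h0 hπ) measurableSet_Ioo).mp hb
  have hsφ : 0 < Real.sin (φ/2) := Real.sin_pos_of_pos_of_lt_pi (by linarith) (by linarith)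
  have hcφ : 0 < Real.cos (φ/2) := Real.cos_pos_of_mem_Ioo ⟨by linarith, by linarith⟩
  set K := (Real.sin (φ/2))⁻¹ * (2 * Real.sin (φ/2) ^ 2) ^ (1 - lam) with hK
  have hKp : 0 < K := by positivity
  refine Integrable.mono' (h2.const_mul (K⁻¹ * (Real.cos (φ/2))⁻¹)) ?_ ?_
  · apply Measurable.aestronglyMeasurable
    fun_prop
  · refine (ae_restrict_iff' measurableSet_Ioo).mpr (ae_of_all _ ?_)
    intro θ hθ
    have hlt := Real.cos_lt_cos_of_nonneg_of_le_pi hθ.1.le hπ.le hθ.2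
    have hp : 0 < (Real.cos θ - Real.cos φ) ^ (lam - 1) := Real.rpow_pos_of_pos (by linarith) _
    have hle : Real.cos (φ/2) ≤ Real.cos (θ/2) :=
      Real.cos_le_cos_of_nonneg_of_le_pi (by linarith [hθ.1]) (by linarith) (by linarith [hθ.2])
    rw [Real.norm_of_nonneg hp.le]
    calc (Real.cos θ - Real.cos φ) ^ (lam - 1) =
        (Real.cos (φ/2))⁻¹ * Real.cos (φ/2) * (Real.cos θ - Real.cos φ) ^ (lam - 1) := by
          field_simp
      _ ≤ (Real.cos (φ/2))⁻¹ * Real.cos (θ/2) * (Real.cos θ - Real.cos φ) ^ (lam - 1) := by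
          gcongr
      _ = _ := by field_simp

lemma mehler_dirichlet {φ lam nu : ℝ} (hl : 0 < lam) (h0 : 0 < φ) (hπ : φ < π) :
    ∫ θ in Set.Ioo 0 φ, Real.cos ((nu + lam) * θ) * (Real.cos θ - Real.cos φ) ^ (lam - 1) =
      2 ^ (-lam) * Real.sqrt π * Real.Gamma lam / Real.Gamma (lam + 1/2) *
        (Real.sin φ ^ (2 * lam - 1) * rG lam nu (Real.cos φ)) := by
  have hsφ : 0 < Real.sin (φ/2) := Real.sin_pos_of_pos_of_lt_pi (by linarith) (by linarith)
  have hcφ : 0 < Real.cos (φ/2) := Real.cos_pos_of_mem_Ioo ⟨by linarith, by linarith⟩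
  have hc1 : ∀ x : ℝ, 1 - Real.cos x = 2 * Real.sin (x/2) ^ 2 := by
    intro x
    have h5 : Real.cos x = 2 * Real.cos (x/2) ^ 2 - 1 := by
      rw [← Real.cos_two_mul]; congr 1; ring
    rw [h5, Real.cos_sq']; ring
  set a := Real.sin (φ/2) ^ 2 with ha
  have ha0 : 0 < a := by positivity
  have ha2 : 1 - a = Real.cos (φ/2) ^ 2 := by rw [Real.cos_sq']
  have ha1 : a < 1 := by nlinarith
  set N := nu + lam with hN
  have hb := hF_beta (1/2 + N) (1/2 - N) hl ha0 ha1
  rw [← cov_image h0 hπ, integral_image_eq_integral_abs_deriv_smul measurableSet_Ioo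
    (cov_deriv φ) (cov_inj hπ)] at hb
  simp only [smul_eq_mul] at hb
  set K := (Real.sin (φ/2))⁻¹ * (2 * Real.sin (φ/2) ^ 2) ^ (1 - lam) with hK
  have hKp : 0 < K := by positivity
  have e1 : ∀ θ ∈ Set.Ioo 0 φ, |Real.sin θ / (1 - Real.cos φ)| *
      (hF (1/2 + N) (1/2 - N) (1/2) (a * ((1 - Real.cos θ) / (1 - Real.cos φ))) *
      (((1 - Real.cos θ) / (1 - Real.cos φ)) ^ ((1/2:ℝ) - 1) *
        (1 - (1 - Real.cos θ) / (1 - Real.cos φ)) ^ (lam - 1))) =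
      K * (Real.cos (N * θ) * (Real.cos θ - Real.cos φ) ^ (lam - 1)) := by
    intro θ hθ
    rw [mul_left_comm, cov_weight h0 hπ θ hθ, ← hK]
    have hcθ : 0 < Real.cos (θ/2) :=
      Real.cos_pos_of_mem_Ioo ⟨by linarith [hθ.1], by linarith [hθ.2]⟩
    have e2 : a * ((1 - Real.cos θ) / (1 - Real.cos φ)) = Real.sin (θ/2) ^ 2 := by
      rw [hc1, hc1, ← ha]; field_simp
    have e4 : 1 - Real.sin (θ/2) ^ 2 = Real.cos (θ/2) ^ 2 := by rw [Real.cos_sq']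
    have hlt : |Real.sin (θ/2) ^ 2| < 1 := by
      rw [abs_of_nonneg (sq_nonneg _)]; nlinarith
    have e3 := euler_transform (-N) N (c := 1/2) (by norm_num) _ hlt
    rw [show (1/2:ℝ) - -N = 1/2 + N by ring, ← cos_eq_hF N θ hθ.1.le (by linarith [hθ.2]), e4,
      sq_rpow' hcθ, show 2 * (-N + N - 1/2) = (-1:ℝ) by ring, Real.rpow_neg_one] at e3
    rw [e2, e3]
    field_simp
  rw [setIntegral_congr_fun measurableSet_Ioo e1, integral_const_mul] at hb
  have e5 := euler_transform (-nu) (nu + 2 * lam) (c := lam + 1/2) (by positivity) a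
    (by rwa [abs_of_pos ha0])
  rw [show lam + 1/2 - -nu = 1/2 + N by rw [hN]; ring,
    show lam + 1/2 - (nu + 2 * lam) = 1/2 - N by rw [hN]; ring] at e5
  rw [e5, ha2] at hb
  rw [rG_eq, show (1 - Real.cos φ) / 2 = a by rw [hc1, ← ha]; ring]
  generalize hF (-nu) (nu + 2 * lam) (lam + 1/2) a = R at *
  have e6 : Real.sin φ = 2 * Real.sin (φ/2) * Real.cos (φ/2) := by
    rw [← Real.sin_two_mul]; congr 1; ring
  have e7 : K⁻¹ * (Real.cos (φ/2) ^ 2) ^ (-nu + (nu + 2 * lam) - (lam + 1/2)) =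
      2 ^ (-lam) * Real.sin φ ^ (2 * lam - 1) := by
    rw [hK, e6, mul_inv, inv_inv, ← Real.rpow_neg (by positivity),
      Real.mul_rpow (by positivity) (by positivity), Real.mul_rpow (by positivity) (by positivity),
      Real.mul_rpow (by positivity) (by positivity), sq_rpow' hsφ, sq_rpow' hcφ]
    have f1 : Real.sin (φ/2) ^ (2 * lam - 1) =
        Real.sin (φ/2) ^ (2 * -(1 - lam)) * Real.sin (φ/2) := by
      rw [← Real.rpow_add_one hsφ.ne']; congr 1; ring
    have f2 : (2:ℝ) ^ (-(1 - lam)) = 2 ^ (-lam) * 2 ^ (2 * lam - 1) := by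
      rw [← Real.rpow_add two_pos]; congr 1; ring
    rw [f1, f2, show 2 * (-nu + (nu + 2 * lam) - (lam + 1/2)) = 2 * lam - 1 by ring]
    ring
  have hfin : ∀ I : ℝ, K * I = Real.sqrt π * Real.Gamma lam / Real.Gamma (lam + 1/2) *
      ((Real.cos (φ/2) ^ 2) ^ (-nu + (nu + 2 * lam) - (lam + 1/2)) * R) →
      I = 2 ^ (-lam) * Real.sqrt π * Real.Gamma lam / Real.Gamma (lam + 1/2) *
        (Real.sin φ ^ (2 * lam - 1) * R) := by
    intro I hI
    have : I = K⁻¹ * (K * I) := by field_simp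
    rw [this, hI]
    linear_combination (Real.sqrt π * Real.Gamma lam / Real.Gamma (lam + 1/2) * R) * e7
  exact hfin _ hb

lemma cpow_one_add_bound {p : ℝ} (hp : p ≤ 1) (y : ℝ) :
    ‖(1 + (y:ℂ) * Complex.I) ^ (p:ℂ) - 1‖ ≤ |p| * |y| := by
  have hd : ∀ s ∈ (Set.univ : Set ℝ), HasDerivWithinAt (fun s : ℝ => (1 + (s:ℂ) * Complex.I) ^ (p:ℂ))
      ((p:ℂ) * (1 + (s:ℂ) * Complex.I) ^ ((p:ℂ) - 1) * Complex.I) Set.univ s := by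
    intro s _
    have h1 : HasDerivAt (fun z : ℂ => 1 + z * Complex.I) Complex.I (s:ℂ) := by
      have := ((hasDerivAt_id (s:ℂ)).mul_const Complex.I).const_add 1
      simpa using this
    have h2 : (1 + (s:ℂ) * Complex.I) ∈ Complex.slitPlane := by
      left; simp
    exact (HasDerivAt.cpow_const (c := (p:ℂ)) h1 h2).comp_ofReal.hasDerivWithinAt
  have hb : ∀ s ∈ (Set.univ : Set ℝ),
      ‖(p:ℂ) * (1 + (s:ℂ) * Complex.I) ^ ((p:ℂ) - 1) * Complex.I‖ ≤ |p| := by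
    intro s _
    rw [norm_mul, norm_mul, Complex.norm_I, mul_one, Complex.norm_real, Real.norm_eq_abs]
    have h3 : 1 ≤ ‖1 + (s:ℂ) * Complex.I‖ := by
      have := Complex.re_le_norm (1 + (s:ℂ) * Complex.I)
      simpa using this
    have h4 : ‖(1 + (s:ℂ) * Complex.I) ^ ((p:ℂ) - 1)‖ ≤ 1 := by
      rw [show (p:ℂ) - 1 = ((p - 1 : ℝ) : ℂ) by push_cast; ring, Complex.norm_cpow_real]
      exact Real.rpow_le_one_of_one_le_of_nonpos h3 (by linarith)
    nlinarith [abs_nonneg p]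
  have := Convex.norm_image_sub_le_of_norm_hasDerivWithin_le hd hb convex_univ
    (Set.mem_univ 0) (Set.mem_univ y)
  simpa using this

lemma sinh_le_mul_cosh {t : ℝ} (ht : 0 ≤ t) : Real.sinh t ≤ t * Real.cosh t := by
  have hmono : MonotoneOn (fun t => t * Real.cosh t - Real.sinh t) (Set.Ici 0) := by
    have hd : ∀ x : ℝ, HasDerivAt (fun t => t * Real.cosh t - Real.sinh t) (x * Real.sinh x) x := by
      intro x
      have := ((hasDerivAt_id x).mul (Real.hasDerivAt_cosh x)).sub (Real.hasDerivAt_sinh x)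
      refine this.congr_deriv ?_
      simp
    apply monotoneOn_of_deriv_nonneg (convex_Ici 0)
    · intro x _; exact (hd x).continuousAt.continuousWithinAt
    · intro x _; exact (hd x).differentiableAt.differentiableWithinAt
    · intro x hx
      rw [interior_Ici] at hx
      rw [(hd x).deriv]
      exact mul_nonneg (le_of_lt hx) (Real.sinh_nonneg_iff.mpr (le_of_lt hx))
  have := hmono (Set.mem_Ici.mpr le_rfl) (Set.mem_Ici.mpr ht) ht
  simp at this
  linarith

lemma sinh_le_mul_exp {t : ℝ} : Real.sinh t ≤ t * Real.exp t := by
  have h := Real.add_one_le_exp (-(2*t))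
  have e : Real.exp (-t) = Real.exp t * Real.exp (-(2*t)) := by
    rw [← Real.exp_add]; congr 1; ring
  rw [Real.sinh_eq, e]
  nlinarith [Real.exp_pos t]

lemma cosh_sub_one (t : ℝ) : Real.cosh t - 1 = 2 * Real.sinh (t/2) ^ 2 := by
  have h : Real.cosh t = Real.cosh (t/2) ^ 2 + Real.sinh (t/2) ^ 2 := by
    rw [← Real.cosh_two_mul]; congr 1; ring
  rw [h, Real.cosh_sq]; ring

lemma cosh_sub_one_le {t : ℝ} (ht : 0 ≤ t) : Real.cosh t - 1 ≤ t * Real.sinh t := by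
  have h : Real.sinh t = 2 * Real.sinh (t/2) * Real.cosh (t/2) := by
    rw [← Real.sinh_two_mul]; congr 1; ring
  have h2 := sinh_le_mul_cosh (t := t/2) (by linarith)
  have h3 : 0 ≤ Real.sinh (t/2) := Real.sinh_nonneg_iff.mpr (by linarith)
  have h4 : 0 ≤ t * Real.sinh t := mul_nonneg ht (Real.sinh_nonneg_iff.mpr ht)
  rw [cosh_sub_one]
  rw [h] at *
  nlinarith

lemma sinh_sub_le {t : ℝ} (ht : 0 ≤ t) : Real.sinh t - t ≤ 2/3 * t^3 * Real.exp t := by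
  have h1 := sinh_le_mul_cosh ht
  have h2 := cosh_sub_one t
  have h3 : 0 ≤ Real.sinh (t/2) := Real.sinh_nonneg_iff.mpr (by linarith)
  have h4 := sinh_le_mul_exp (t := t/2)
  have h5 : Real.sinh (t/2) ^ 2 ≤ (t/2 * Real.exp (t/2))^2 := by gcongr
  have h6 : (t/2 * Real.exp (t/2))^2 = t^2/4 * Real.exp t := by
    rw [mul_pow, ← Real.exp_nat_mul]; push_cast
    rw [show 2 * (t/2) = t by ring]; ring
  rw [h6] at h5
  have h7 : t * (Real.cosh t - 1) ≤ t * (2 * (t^2/4 * Real.exp t)) := by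
    rw [h2]; gcongr
  have h8 : 0 ≤ t^3 * Real.exp t := by positivity
  nlinarith

lemma rpow_sub_one_abs {p s : ℝ} (hp : p ≤ 1) (hs : 1 ≤ s) : |s ^ p - 1| ≤ |p| * (s - 1) := by
  rcases le_or_gt 0 p with h | h
  · have h1 : 1 ≤ s ^ p := Real.one_le_rpow hs h
    rw [abs_of_nonneg (by linarith), abs_of_nonneg h]
    have := rpow_one_add_le_one_add_mul_self (s := s - 1) (by linarith) h hp
    rw [show 1 + (s - 1) = s by ring] at this
    linarith
  · have h1 : s ^ p ≤ 1 := Real.rpow_le_one_of_one_le_of_nonpos hs h.le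
    rw [abs_of_nonpos (by linarith), abs_of_neg h]
    have hs0 : 0 < s := by linarith
    have h2 : s ^ p = Real.exp (Real.log s * p) := Real.rpow_def_of_pos hs0 p
    have h3 := Real.add_one_le_exp (Real.log s * p)
    have h4 := Real.log_le_sub_one_of_pos hs0
    rw [h2]
    nlinarith

/-- the kernel on the vertical ray -/
noncomputable def rayM (lam c t : ℝ) : ℂ :=
  ((Real.sinh t ^ (lam - 1) : ℝ) : ℂ) *
    (1 + ((c * ((Real.cosh t - 1) / Real.sinh t) : ℝ) : ℂ) * Complex.I) ^ ((lam - 1 : ℝ) : ℂ)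

lemma rayM_bound {lam : ℝ} (h2 : lam ≤ 2) (c : ℝ) {t : ℝ} (ht : 0 < t) :
    ‖rayM lam c t - ((t ^ (lam - 1) : ℝ) : ℂ)‖ ≤
      Real.exp t * (|lam - 1| * (|c| * t ^ lam + 2/3 * t ^ (lam + 1))) := by
  have hsh : 0 < Real.sinh t := Real.sinh_pos_iff.mpr ht
  set p := lam - 1 with hp
  have hp1 : p ≤ 1 := by rw [hp]; linarith
  set s := Real.sinh t / t with hs
  have hs1 : 1 ≤ s := by
    rw [hs, le_div_iff₀ ht, one_mul]; exact Real.self_le_sinh_iff.mpr ht.le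
  have hse : s ≤ Real.exp t := by
    rw [hs, div_le_iff₀ ht, mul_comm]; exact sinh_le_mul_exp
  have hst : s - 1 ≤ 2/3 * t^2 * Real.exp t := by
    have : s - 1 = (Real.sinh t - t) / t := by rw [hs]; field_simp
    rw [this, div_le_iff₀ ht]
    have := sinh_sub_le ht.le
    linarith
  have hsp : Real.sinh t ^ p = t ^ p * s ^ p := by
    rw [← Real.mul_rpow ht.le (by linarith)]; congr 1; rw [hs]; field_simp
  have hspe : s ^ p ≤ Real.exp t := by
    calc s ^ p ≤ s ^ (1:ℝ) := Real.rpow_le_rpow_of_exponent_le hs1 hp1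
      _ = s := Real.rpow_one s
      _ ≤ _ := hse
  have htp : 0 < t ^ p := Real.rpow_pos_of_pos ht p
  have hsp0 : 0 < s ^ p := Real.rpow_pos_of_pos (by linarith) p
  have htl : t ^ lam = t ^ p * t := by
    rw [← Real.rpow_add_one ht.ne']; congr 1; rw [hp]; ring
  have htl1 : t ^ (lam + 1) = t ^ p * t^2 := by
    rw [Real.rpow_add_one ht.ne', htl]; ring
  have hy : |c * ((Real.cosh t - 1) / Real.sinh t)| ≤ |c| * t := by
    have h3 : 0 ≤ Real.cosh t - 1 := by linarith [Real.one_le_cosh t]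
    rw [abs_mul, abs_of_nonneg (div_nonneg h3 hsh.le)]
    gcongr
    rw [div_le_iff₀ hsh]; exact cosh_sub_one_le ht.le
  set W := (1 + ((c * ((Real.cosh t - 1) / Real.sinh t) : ℝ) : ℂ) * Complex.I) ^ (p : ℂ) with hW
  have hWb : ‖W - 1‖ ≤ |p| * (|c| * t) :=
    (cpow_one_add_bound hp1 _).trans (by gcongr)
  have e : rayM lam c t - ((t ^ p : ℝ) : ℂ) = ((t ^ p * s ^ p : ℝ) : ℂ) * (W - 1) +
      ((t ^ p * (s ^ p - 1) : ℝ) : ℂ) := by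
    rw [rayM, ← hp, ← hW, hsp]; push_cast; ring
  rw [e]
  refine (norm_add_le _ _).trans ?_
  rw [norm_mul, Complex.norm_real, Complex.norm_real, Real.norm_of_nonneg (by positivity),
    Real.norm_eq_abs, abs_mul, abs_of_pos htp, htl, htl1]
  have h9 := rpow_sub_one_abs hp1 hs1
  calc t ^ p * s ^ p * ‖W - 1‖ + t ^ p * |s ^ p - 1| ≤
      t ^ p * Real.exp t * (|p| * (|c| * t)) + t ^ p * (|p| * (2/3 * t^2 * Real.exp t)) := by
        gcongr
        exact h9.trans (by gcongr)
    _ = _ := by ring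

lemma gamma_integrable {a r : ℝ} (ha : 0 < a) (hr : 0 < r) :
    IntegrableOn (fun t : ℝ => t ^ (a - 1) * Real.exp (-(r * t))) (Set.Ioi 0) := by
  have := integrableOn_rpow_mul_exp_neg_mul_rpow (p := 1) (s := a - 1) (b := r) (by linarith)
    one_pos hr
  simpa using this

lemma rayM_measurable (lam c : ℝ) : Measurable (rayM lam c) := by
  unfold rayM
  have h1 : Measurable (fun t : ℝ => Real.sinh t) := Real.continuous_sinh.measurable
  have h2 : Measurable (fun t : ℝ => Real.cosh t) := Real.continuous_cosh.measurable
  refine Measurable.mul ?_ ?_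
  · exact Complex.measurable_ofReal.comp (h1.pow_const _)
  · refine Measurable.pow_const ?_ _
    refine (Measurable.mul_const ?_ _).const_add _
    exact Complex.measurable_ofReal.comp (((h2.sub_const 1).div h1).const_mul c)

lemma ray_diff_bound {lam N : ℝ} (h0 : 0 < lam) (h2 : lam ≤ 2) (hN : 1 < N) (c : ℝ) :
    IntegrableOn (fun t : ℝ => ((Real.exp (-(N * t)) : ℝ) : ℂ) * rayM lam c t) (Set.Ioi 0) ∧
    ‖(∫ t in Set.Ioi (0:ℝ), ((Real.exp (-(N * t)) : ℝ) : ℂ) * rayM lam c t) -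
      ((Real.Gamma lam / N ^ lam : ℝ) : ℂ)‖ ≤
      Real.Gamma lam * (lam * |lam - 1| / (N - 1) ^ (lam + 1) *
        (|c| + 2/3 * (lam + 1) / (N - 1))) := by
  have hN0 : 0 < N := by linarith
  have hN1 : 0 < N - 1 := by linarith
  have i0 := gamma_integrable h0 hN0
  have i1 := gamma_integrable (a := lam + 1) (by linarith) hN1
  have i2 := gamma_integrable (a := lam + 2) (by linarith) hN1
  set B : ℝ → ℝ := fun t => |lam - 1| * (|c| * (t ^ (lam + 1 - 1) * Real.exp (-((N - 1) * t))) +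
    2/3 * (t ^ (lam + 2 - 1) * Real.exp (-((N - 1) * t)))) with hB
  have iB : IntegrableOn B (Set.Ioi 0) := ((i1.const_mul _).add (i2.const_mul _)).const_mul _
  set D : ℝ → ℂ := fun t => ((Real.exp (-(N * t)) : ℝ) : ℂ) *
    (rayM lam c t - ((t ^ (lam - 1) : ℝ) : ℂ)) with hD
  have hDB : ∀ t ∈ Set.Ioi (0:ℝ), ‖D t‖ ≤ B t := by
    intro t ht
    have := rayM_bound h2 c (t := t) ht
    simp only [hD, hB]
    rw [norm_mul, Complex.norm_real, Real.norm_of_nonneg (Real.exp_pos _).le]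
    have e : Real.exp (-((N - 1) * t)) = Real.exp (-(N*t)) * Real.exp t := by
      rw [← Real.exp_add]; congr 1; ring
    rw [e, show lam + 1 - 1 = lam by ring, show lam + 2 - 1 = lam + 1 by ring]
    calc _ ≤ Real.exp (-(N*t)) *
        (Real.exp t * (|lam - 1| * (|c| * t ^ lam + 2/3 * t ^ (lam + 1)))) := by gcongr
      _ = _ := by ring
  have hDB' : ∀ᵐ t ∂(volume.restrict (Set.Ioi (0:ℝ))), ‖D t‖ ≤ B t :=
    (ae_restrict_iff' measurableSet_Ioi).mpr (ae_of_all _ hDB)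
  have hDm : Measurable D := by
    have h1 : Measurable (fun t : ℝ => ((Real.exp (-(N * t)) : ℝ) : ℂ)) := by fun_prop
    have h3 : Measurable (fun t : ℝ => ((t ^ (lam - 1) : ℝ) : ℂ)) := by fun_prop
    exact h1.mul ((rayM_measurable lam c).sub h3)
  have iD : IntegrableOn D (Set.Ioi 0) := Integrable.mono' iB hDm.aestronglyMeasurable hDB'
  have iG : IntegrableOn (fun t : ℝ => ((t ^ (lam - 1) * Real.exp (-(N * t)) : ℝ) : ℂ))
    (Set.Ioi 0) := i0.ofReal
  have hsum : ∀ t : ℝ, ((Real.exp (-(N * t)) : ℝ) : ℂ) * rayM lam c t =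
      D t + ((t ^ (lam - 1) * Real.exp (-(N * t)) : ℝ) : ℂ) := by
    intro t; simp only [hD]; push_cast; ring
  simp_rw [hsum]
  refine ⟨iD.add iG, ?_⟩
  rw [integral_add iD iG, integral_complex_ofReal,
    Real.integral_rpow_mul_exp_neg_mul_Ioi h0 hN0]
  have e1 : (1 / N) ^ lam * Real.Gamma lam = Real.Gamma lam / N ^ lam := by
    rw [Real.div_rpow zero_le_one hN0.le, Real.one_rpow]; ring
  rw [e1, add_sub_cancel_right]
  refine (norm_integral_le_of_norm_le iB hDB').trans (le_of_eq ?_)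
  simp only [hB]
  rw [integral_const_mul, integral_add (i1.const_mul _) (i2.const_mul _), integral_const_mul,
    integral_const_mul, Real.integral_rpow_mul_exp_neg_mul_Ioi (by linarith) hN1,
    Real.integral_rpow_mul_exp_neg_mul_Ioi (by linarith) hN1,
    show lam + 2 = lam + 1 + 1 by ring, Real.Gamma_add_one (s := lam + 1) (by linarith),
    Real.Gamma_add_one h0.ne', Real.rpow_add_one (by positivity) (lam + 1),
    Real.div_rpow zero_le_one hN1.le, Real.one_rpow]
  have : (N - 1) ^ (lam + 1) ≠ 0 := (Real.rpow_pos_of_pos hN1 _).ne'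
  field_simp

/-- the integrand of the contour integral -/
noncomputable def cf (lam N φ : ℝ) (w : ℂ) : ℂ :=
  Complex.exp (Complex.I * N * w) * (Complex.cos w - (Real.cos φ : ℂ)) ^ ((lam - 1 : ℝ) : ℂ)

lemma cos_add_I (θ t : ℝ) (φ : ℝ) : Complex.cos ((θ:ℂ) + (t:ℂ) * Complex.I) - (Real.cos φ : ℂ) =
    ((Real.cos θ * Real.cosh t - Real.cos φ : ℝ) : ℂ) +
      ((-(Real.sin θ * Real.sinh t) : ℝ) : ℂ) * Complex.I := by
  rw [Complex.cos_add_mul_I]; push_cast; ring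

lemma base_slit {φ θ t : ℝ} (hπ : φ < π) (h0 : 0 < φ) (hθ : θ ∈ Set.Icc 0 φ) (ht : 0 < t) :
    Complex.cos ((θ:ℂ) + (t:ℂ) * Complex.I) - (Real.cos φ : ℂ) ∈ Complex.slitPlane := by
  rw [cos_add_I]
  have hsh : 0 < Real.sinh t := Real.sinh_pos_iff.mpr ht
  rcases hθ.1.eq_or_lt with h | h
  · left
    have h1 := Real.cos_lt_cos_of_nonneg_of_le_pi le_rfl hπ.le h0
    have h2 := Real.one_le_cosh t
    rw [← h, Complex.add_re, Complex.ofReal_re, Complex.re_ofReal_mul, Complex.I_re, mul_zero,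
      add_zero, Real.cos_zero, one_mul]
    rw [Real.cos_zero] at h1
    linarith
  · right
    have h1 : 0 < Real.sin θ := Real.sin_pos_of_pos_of_lt_pi h (by linarith [hθ.2])
    have h2 : Real.sin θ * Real.sinh t ≠ 0 := by positivity
    rw [Complex.add_im, Complex.ofReal_im, Complex.im_ofReal_mul, Complex.I_im, mul_one, zero_add]
    exact neg_ne_zero.mpr h2

lemma base_normSq (φ θ t : ℝ) :
    ‖Complex.cos ((θ:ℂ) + (t:ℂ) * Complex.I) - (Real.cos φ : ℂ)‖ ^ 2 =
    (Real.cos θ * Real.cosh t - Real.cos φ) ^ 2 + (Real.sin θ * Real.sinh t) ^ 2 := by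
  rw [cos_add_I, Complex.sq_norm, Complex.normSq_add_mul_I]; ring

lemma base_lower (φ θ t : ℝ) : Real.cos θ - Real.cos φ ≤
    ‖Complex.cos ((θ:ℂ) + (t:ℂ) * Complex.I) - (Real.cos φ : ℂ)‖ := by
  refine (abs_le_of_sq_le_sq' ?_ (norm_nonneg _)).2
  rw [base_normSq]
  have h1 := Real.sin_sq_add_cos_sq θ
  have h2 := Real.cosh_sq_sub_sinh_sq t
  have h3 := Real.one_le_cosh t
  have h4 : Real.cos θ * Real.cos φ ≤ 1 := by
    nlinarith [sq_nonneg (Real.cos θ - Real.cos φ), Real.cos_sq_le_one θ, Real.cos_sq_le_one φ]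
  have h5 : 0 ≤ (Real.cosh t - 1) * (Real.cosh t + 1 - 2 * (Real.cos θ * Real.cos φ)) :=
    mul_nonneg (by linarith) (by linarith)
  have e : (Real.cos θ * Real.cosh t - Real.cos φ) ^ 2 + (Real.sin θ * Real.sinh t) ^ 2 =
      (Real.cos θ - Real.cos φ) ^ 2 +
      (Real.cosh t - 1) * (Real.cosh t + 1 - 2 * (Real.cos θ * Real.cos φ)) := by
    rw [mul_pow (Real.sin θ), show Real.sin θ ^ 2 = 1 - Real.cos θ ^ 2 by linarith,
      show Real.sinh t ^ 2 = Real.cosh t ^ 2 - 1 by linarith]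
    ring
  linarith

lemma norm_cos_sq (θ t : ℝ) : ‖Complex.cos ((θ:ℂ) + (t:ℂ) * Complex.I)‖ ^ 2 =
    Real.sinh t ^ 2 + Real.cos θ ^ 2 := by
  have h := base_normSq (π / 2) θ t
  rw [Real.cos_pi_div_two, Complex.ofReal_zero, sub_zero, sub_zero] at h
  rw [h, mul_pow, mul_pow, show Real.sin θ ^ 2 = 1 - Real.cos θ ^ 2 by
      linarith [Real.sin_sq_add_cos_sq θ],
    show Real.cosh t ^ 2 = Real.sinh t ^ 2 + 1 by linarith [Real.cosh_sq_sub_sinh_sq t]]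
  ring

lemma base_lower2 (φ θ t : ℝ) : Real.sinh t - 1 ≤
    ‖Complex.cos ((θ:ℂ) + (t:ℂ) * Complex.I) - (Real.cos φ : ℂ)‖ := by
  have h1 : Real.sinh t ≤ ‖Complex.cos ((θ:ℂ) + (t:ℂ) * Complex.I)‖ := by
    refine (abs_le_of_sq_le_sq' ?_ (norm_nonneg _)).2
    rw [norm_cos_sq]
    linarith [sq_nonneg (Real.cos θ)]
  have h2 := norm_sub_norm_le (Complex.cos ((θ:ℂ) + (t:ℂ) * Complex.I)) (Real.cos φ : ℂ)
  have h3 : ‖(Real.cos φ : ℂ)‖ ≤ 1 := by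
    rw [Complex.norm_real]; exact Real.abs_cos_le_one φ
  linarith

lemma base_upper (φ θ t : ℝ) :
    ‖Complex.cos ((θ:ℂ) + (t:ℂ) * Complex.I) - (Real.cos φ : ℂ)‖ ≤ Real.cosh t + 1 := by
  have h1 : ‖Complex.cos ((θ:ℂ) + (t:ℂ) * Complex.I)‖ ≤ Real.cosh t := by
    refine (abs_le_of_sq_le_sq' ?_ (Real.cosh_pos t).le).2
    rw [norm_cos_sq]
    linarith [Real.cos_sq_le_one θ, Real.cosh_sq_sub_sinh_sq t]
  have h2 := norm_sub_le (Complex.cos ((θ:ℂ) + (t:ℂ) * Complex.I)) (Real.cos φ : ℂ)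
  have h3 : ‖(Real.cos φ : ℂ)‖ ≤ 1 := by
    rw [Complex.norm_real]; exact Real.abs_cos_le_one φ
  linarith

lemma cf_norm (lam N φ θ t : ℝ) : ‖cf lam N φ ((θ:ℂ) + (t:ℂ) * Complex.I)‖ = Real.exp (-(N*t)) *
    ‖Complex.cos ((θ:ℂ) + (t:ℂ) * Complex.I) - (Real.cos φ : ℂ)‖ ^ (lam - 1) := by
  rw [cf, norm_mul, Complex.norm_cpow_real, Complex.norm_exp]
  congr 2
  simp

lemma cf_diff {lam N φ : ℝ} (w : ℂ) (hw : Complex.cos w - (Real.cos φ : ℂ) ∈ Complex.slitPlane) :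
    DifferentiableAt ℂ (cf lam N φ) w := by
  unfold cf
  refine DifferentiableAt.mul (by fun_prop) ?_
  exact DifferentiableAt.cpow_const (Complex.differentiableAt_cos.sub_const _) hw

lemma cf_measurable (lam N φ : ℝ) : Measurable (cf lam N φ) := by
  unfold cf
  have h1 : Measurable Complex.cos := Complex.continuous_cos.measurable
  exact (by fun_prop : Measurable fun w : ℂ => Complex.exp (Complex.I * N * w)).mul
    ((h1.sub_const _).pow_const _)

lemma cauchy_rect {lam N φ ε T : ℝ} (h0 : 0 < φ) (hπ : φ < π) (hε : 0 < ε) (hT : ε ≤ T) :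
    (∫ x in (0:ℝ)..φ, cf lam N φ (x + (ε:ℂ) * Complex.I)).re -
      (∫ x in (0:ℝ)..φ, cf lam N φ (x + (T:ℂ) * Complex.I)).re +
      (Complex.I * ∫ y in ε..T, cf lam N φ ((φ:ℂ) + (y:ℂ) * Complex.I)).re = 0 := by
  have h := Complex.integral_boundary_rect_eq_zero_of_differentiableOn (cf lam N φ)
    ((ε:ℂ) * Complex.I) ((φ:ℂ) + (T:ℂ) * Complex.I) ?_
  · simp only [Complex.mul_re, Complex.ofReal_re, Complex.I_re, mul_zero, Complex.ofReal_im,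
      Complex.I_im, mul_one, sub_zero, Complex.add_re, add_zero, Complex.mul_im, Complex.add_im,
      zero_add, smul_eq_mul, sub_self, Complex.ofReal_zero, zero_mul] at h
    have hz : (Complex.I * ∫ y in ε..T, cf lam N φ ((y:ℂ) * Complex.I)).re = 0 := by
      have e : ∀ y ∈ Set.uIcc ε T, cf lam N φ ((y:ℂ) * Complex.I) =
          ((Real.exp (-(N*y)) * (Real.cosh y - Real.cos φ) ^ (lam - 1) : ℝ) : ℂ) := by
        intro y _
        have h1 : 0 ≤ Real.cosh y - Real.cos φ := by
          linarith [Real.one_le_cosh y, Real.cos_le_one φ]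
        rw [cf, Complex.cos_mul_I, Complex.ofReal_mul, Complex.ofReal_cpow h1]
        congr 1
        · rw [show Complex.I * N * (y * Complex.I) = (Complex.I * Complex.I) * (N * y) by ring,
            Complex.I_mul_I]
          push_cast; ring_nf
        · push_cast; rfl
      rw [intervalIntegral.integral_congr e, intervalIntegral.integral_ofReal]
      simp
    have h3 := congrArg Complex.re h
    rw [Complex.sub_re, hz, Complex.add_re, Complex.sub_re, Complex.zero_re, sub_zero] at h3
    exact h3
  · intro w hw
    apply DifferentiableAt.differentiableWithinAt
    apply cf_diff
    rw [Complex.mem_reProdIm] at hw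
    simp only [Complex.mul_re, Complex.ofReal_re, Complex.I_re, mul_zero, Complex.ofReal_im,
      Complex.I_im, mul_one, sub_zero, Complex.add_re, add_zero, Complex.mul_im, Complex.add_im,
      zero_add, sub_self, Set.uIcc_of_le h0.le, Set.uIcc_of_le hT] at hw
    rw [← Complex.re_add_im w]
    exact base_slit hπ h0 hw.1 (hε.trans_le hw.2.1)

lemma cf_ray {lam N φ t : ℝ} (h0 : 0 < φ) (hπ : φ < π) (ht : 0 < t) :
    cf lam N φ ((φ:ℂ) + (t:ℂ) * Complex.I) =
      (Complex.I * Complex.exp (((N * φ - lam * π / 2 : ℝ) : ℂ) * Complex.I) *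
        ((Real.sin φ ^ (lam - 1) : ℝ) : ℂ)) *
      (((Real.exp (-(N * t)) : ℝ) : ℂ) * rayM lam (Real.cos φ / Real.sin φ) t) := by
  have hs : 0 < Real.sin φ := Real.sin_pos_of_pos_of_lt_pi h0 hπ
  have hsh : 0 < Real.sinh t := Real.sinh_pos_iff.mpr ht
  rw [cf, rayM, cos_add_I]
  set y : ℝ := Real.cos φ / Real.sin φ * ((Real.cosh t - 1) / Real.sinh t) with hy
  set z : ℂ := 1 + (y:ℂ) * Complex.I with hz
  have hzre : z.re = 1 := by simp [hz]
  have hz0 : z ≠ 0 := by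
    intro h; rw [h] at hzre; simp at hzre
  have hIz : -Complex.I * z ≠ 0 := mul_ne_zero (neg_ne_zero.mpr Complex.I_ne_zero) hz0
  have hr : 0 < Real.sin φ * Real.sinh t := by positivity
  have e1 : ((Real.cos φ * Real.cosh t - Real.cos φ : ℝ) : ℂ) +
      ((-(Real.sin φ * Real.sinh t) : ℝ) : ℂ) * Complex.I =
      ((Real.sin φ * Real.sinh t : ℝ) : ℂ) * (-Complex.I * z) := by
    have h5 : Real.cos φ * Real.cosh t - Real.cos φ = Real.sin φ * Real.sinh t * y := by
      rw [hy]; field_simp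
    rw [h5, hz]; push_cast
    linear_combination (Complex.sin φ * Complex.sinh t * y) * Complex.I_mul_I
  have harg : -Complex.I * z ≠ 0 ∧ Complex.log (-Complex.I * z) =
      -(π/2) * Complex.I + Complex.log z := by
    refine ⟨hIz, ?_⟩
    rw [Complex.log_mul (neg_ne_zero.mpr Complex.I_ne_zero) hz0, Complex.log_neg_I]
    have := (Complex.abs_arg_lt_pi_div_two_iff (z := z)).mpr (Or.inl (by rw [hzre]; exact one_pos))
    rw [abs_lt] at this
    rw [Complex.arg_neg_I]
    constructor <;> linarith [this.1, this.2]
  rw [e1, Complex.cpow_def_of_ne_zero (mul_ne_zero (by exact_mod_cast hr.ne') hIz),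
    Complex.log_ofReal_mul hr hIz, harg.2, Complex.cpow_def_of_ne_zero hz0,
    Real.rpow_def_of_pos hs, Real.rpow_def_of_pos hsh, Real.log_mul hs.ne' hsh.ne']
  push_cast
  have hI : Complex.I = Complex.exp (π / 2 * Complex.I) := Complex.exp_pi_div_two_mul_I.symm
  have hI2 : ∀ E : ℂ, Complex.I * E = Complex.exp (π / 2 * Complex.I) * E := fun E => by rw [← hI]
  rw [hI2 (Complex.exp (((N:ℂ) * φ - lam * π / 2) * Complex.I))]
  simp only [← Complex.exp_add]
  congr 1
  linear_combination ((N:ℂ) * t) * Complex.I_mul_I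

lemma bottom_limit {lam N φ : ℝ} (hl : 0 < lam) (hN : 0 < N) (h0 : 0 < φ) (hπ : φ < π) :
    Tendsto (fun n : ℕ => ∫ x in (0:ℝ)..φ,
      cf lam N φ (x + ((1 / ((n:ℝ) + 1) : ℝ) : ℂ) * Complex.I)) atTop
      (𝓝 (∫ x in Set.Ioo (0:ℝ) φ, cf lam N φ x)) := by
  simp_rw [intervalIntegral.integral_of_le h0.le, integral_Ioc_eq_integral_Ioo]
  have hmem : ∀ᵐ x ∂(volume.restrict (Set.Ioo 0 φ)), x ∈ Set.Ioo 0 φ :=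
    ae_restrict_mem measurableSet_Ioo
  refine tendsto_integral_of_dominated_convergence
    (fun x => (Real.cos x - Real.cos φ) ^ (lam - 1) + (Real.cosh 1 + 1) ^ (lam - 1)) ?_ ?_ ?_ ?_
  · intro n
    apply Measurable.aestronglyMeasurable
    exact (cf_measurable lam N φ).comp (by fun_prop)
  · apply Integrable.add (kernel_integrable hl h0 hπ)
    exact integrableOn_const (by simp)
  · intro n
    filter_upwards [hmem] with x hx
    rw [cf_norm]
    have hn : 0 < 1 / ((n:ℝ) + 1) := by positivity
    have hn1 : 1 / ((n:ℝ) + 1) ≤ 1 := by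
      rw [div_le_one (by positivity)]; linarith [(Nat.cast_nonneg n : (0:ℝ) ≤ n)]
    have hlt := Real.cos_lt_cos_of_nonneg_of_le_pi hx.1.le hπ.le hx.2
    have hlow := base_lower φ x (1 / ((n:ℝ) + 1))
    have hup := base_upper φ x (1 / ((n:ℝ) + 1))
    have hch : Real.cosh (1 / ((n:ℝ) + 1)) ≤ Real.cosh 1 := by
      rw [Real.cosh_le_cosh, abs_of_pos hn, abs_one]; exact hn1
    have hexp : Real.exp (-(N * (1 / ((n:ℝ) + 1)))) ≤ 1 := by
      rw [Real.exp_le_one_iff]; have := mul_pos hN hn; linarith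
    set Z := ‖Complex.cos ((x:ℂ) + ((1 / ((n:ℝ) + 1) : ℝ) : ℂ) * Complex.I) - (Real.cos φ : ℂ)‖
    have hp1 : 0 ≤ (Real.cos x - Real.cos φ) ^ (lam - 1) := Real.rpow_nonneg (by linarith) _
    have hch0 := Real.one_le_cosh 1
    have hp2 : 0 ≤ (Real.cosh 1 + 1) ^ (lam - 1) := Real.rpow_nonneg (by linarith) _
    have hZ0 : 0 < Z := by linarith
    have hZ : Z ^ (lam - 1) ≤ (Real.cos x - Real.cos φ) ^ (lam - 1) +
        (Real.cosh 1 + 1) ^ (lam - 1) := by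
      rcases le_total lam 1 with h | h
      · have := Real.rpow_le_rpow_of_nonpos (z := lam - 1) (sub_pos.mpr hlt) hlow (by linarith)
        linarith
      · have := Real.rpow_le_rpow (z := lam - 1) hZ0.le
          (hup.trans (by linarith : _ ≤ Real.cosh 1 + 1)) (by linarith)
        linarith
    have := Real.rpow_nonneg hZ0.le (lam - 1)
    calc _ ≤ 1 * Z ^ (lam - 1) := by gcongr
      _ ≤ _ := by linarith
  · filter_upwards [hmem] with x hx
    have hlt := Real.cos_lt_cos_of_nonneg_of_le_pi hx.1.le hπ.le hx.2
    have hc : ContinuousAt (cf lam N φ) (x:ℂ) := by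
      apply DifferentiableAt.continuousAt (𝕜 := ℂ)
      apply cf_diff
      left
      rw [← Complex.ofReal_cos, ← Complex.ofReal_sub, Complex.ofReal_re]
      linarith
    have ht : Tendsto (fun n : ℕ => (x:ℂ) + ((1 / ((n:ℝ) + 1) : ℝ) : ℂ) * Complex.I) atTop
        (𝓝 (x:ℂ)) := by
      have h1 : Tendsto (fun n : ℕ => ((1 / ((n:ℝ) + 1) : ℝ) : ℂ)) atTop (𝓝 ((0:ℝ):ℂ)) :=
        (Complex.continuous_ofReal.tendsto 0).comp tendsto_one_div_add_atTop_nhds_zero_nat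
      have h2 := (h1.mul_const Complex.I).const_add (x:ℂ)
      simpa using h2
    exact hc.tendsto.comp ht

lemma top_limit {lam N φ : ℝ} (hl2 : lam ≤ 2) (hN : 1 < N) (h0 : 0 < φ) :
    Tendsto (fun n : ℕ => ∫ x in (0:ℝ)..φ,
      cf lam N φ (x + (((n:ℝ) + 2 : ℝ) : ℂ) * Complex.I)) atTop (𝓝 0) := by
  have hlim : Tendsto (fun n : ℕ => 2 * Real.exp (-((N - 1) * ((n:ℝ) + 2))) * |φ - 0|) atTop
      (𝓝 (2 * 0 * |φ - 0|)) := by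
    refine ((Tendsto.const_mul 2 ?_)).mul_const _
    refine Real.tendsto_exp_neg_atTop_nhds_zero.comp ?_
    refine Tendsto.const_mul_atTop (by linarith) ?_
    exact tendsto_atTop_add_const_right _ _ tendsto_natCast_atTop_atTop
  rw [mul_zero, zero_mul] at hlim
  refine squeeze_zero_norm (fun n => ?_) hlim
  apply intervalIntegral.norm_integral_le_of_norm_le_const
  intro x _
  rw [cf_norm]
  set T : ℝ := (n:ℝ) + 2 with hT
  have hT2 : 2 ≤ T := by rw [hT]; linarith [(Nat.cast_nonneg n : (0:ℝ) ≤ n)]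
  clear_value T
  have hlow := base_lower2 φ x T
  have hup := base_upper φ x T
  have hsh : T ≤ Real.sinh T := Real.self_le_sinh_iff.mpr (by linarith)
  set Z := ‖Complex.cos ((x:ℂ) + (T : ℂ) * Complex.I) - (Real.cos φ : ℂ)‖
  have hZ1 : 1 ≤ Z := by linarith
  have hZ : Z ^ (lam - 1) ≤ 2 * Real.exp T := by
    calc Z ^ (lam - 1) ≤ Z ^ (1:ℝ) := Real.rpow_le_rpow_of_exponent_le hZ1 (by linarith)
      _ = Z := Real.rpow_one Z
      _ ≤ Real.cosh T + 1 := hup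
      _ ≤ 2 * Real.exp T := by
        rw [Real.cosh_eq]
        have h1 : Real.exp (-T) ≤ 1 := Real.exp_le_one_iff.mpr (by linarith)
        have h2 : 1 ≤ Real.exp T := Real.one_le_exp (by linarith)
        linarith
  calc _ ≤ Real.exp (-(N*T)) * (2 * Real.exp T) := by gcongr
    _ = _ := by
      rw [show -((N-1)*T) = -(N*T) + T by ring, Real.exp_add]; ring

lemma ray_limit {F : ℝ → ℂ} (hF : IntegrableOn F (Set.Ioi 0)) :
    Tendsto (fun n : ℕ => ∫ y in (1 / ((n:ℝ) + 1))..((n:ℝ) + 2), F y) atTop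
      (𝓝 (∫ y in Set.Ioi (0:ℝ), F y)) := by
  have hle : ∀ n : ℕ, 1 / ((n:ℝ) + 1) ≤ (n:ℝ) + 2 := by
    intro n
    have : 1 / ((n:ℝ) + 1) ≤ 1 := by
      rw [div_le_one (by positivity)]; linarith [(Nat.cast_nonneg n : (0:ℝ) ≤ n)]
    linarith [(Nat.cast_nonneg n : (0:ℝ) ≤ n)]
  have hcov : AECover (volume.restrict (Set.Ioi (0:ℝ))) atTop
      (fun n : ℕ => Set.Ioc (1 / ((n:ℝ) + 1)) ((n:ℝ) + 2)) := by
    constructor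
    · filter_upwards [ae_restrict_mem measurableSet_Ioi] with x hx
      have h1 := (tendsto_one_div_add_atTop_nhds_zero_nat (𝕜 := ℝ)).eventually_lt_const
        (show (0:ℝ) < x from hx)
      have h2 : Tendsto (fun n : ℕ => (n:ℝ) + 2) atTop atTop :=
        tendsto_atTop_add_const_right _ _ tendsto_natCast_atTop_atTop
      filter_upwards [h1, h2.eventually_ge_atTop x] with n hn1 hn2
      exact ⟨hn1, hn2⟩
    · intro n; exact measurableSet_Ioc
  have := hcov.integral_tendsto_of_countably_generated hF
  refine this.congr ?_
  intro n
  rw [intervalIntegral.integral_of_le (hle n), Measure.restrict_restrict measurableSet_Ioc,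
    Set.inter_eq_left.mpr]
  intro x hx
  have : 0 < 1 / ((n:ℝ) + 1) := by positivity
  exact this.trans hx.1

lemma contour {lam N φ : ℝ} (hl : 0 < lam) (hl2 : lam ≤ 2) (hN : 1 < N) (h0 : 0 < φ)
    (hπ : φ < π) :
    ∫ θ in Set.Ioo 0 φ, Real.cos (N * θ) * (Real.cos θ - Real.cos φ) ^ (lam - 1) =
      Real.sin φ ^ (lam - 1) * (Complex.exp (((N * φ - lam * π / 2 : ℝ) : ℂ) * Complex.I) *
        ∫ t in Set.Ioi (0:ℝ), ((Real.exp (-(N * t)) : ℝ) : ℂ) *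
          rayM lam (Real.cos φ / Real.sin φ) t).re := by
  set J := ∫ t in Set.Ioi (0:ℝ), ((Real.exp (-(N * t)) : ℝ) : ℂ) *
          rayM lam (Real.cos φ / Real.sin φ) t with hJ
  set E := Complex.exp (((N * φ - lam * π / 2 : ℝ) : ℂ) * Complex.I) with hE
  have hint := (ray_diff_bound hl hl2 hN (Real.cos φ / Real.sin φ)).1
  have hray : ∀ t ∈ Set.Ioi (0:ℝ), cf lam N φ ((φ:ℂ) + (t:ℂ) * Complex.I) =
      (Complex.I * E * ((Real.sin φ ^ (lam - 1) : ℝ) : ℂ)) *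
      (((Real.exp (-(N * t)) : ℝ) : ℂ) * rayM lam (Real.cos φ / Real.sin φ) t) :=
    fun t ht => cf_ray h0 hπ ht
  have hFi : IntegrableOn (fun t : ℝ => cf lam N φ ((φ:ℂ) + (t:ℂ) * Complex.I)) (Set.Ioi 0) := by
    rw [integrableOn_congr_fun hray measurableSet_Ioi]
    exact hint.const_mul _
  have hFv : ∫ t in Set.Ioi (0:ℝ), cf lam N φ ((φ:ℂ) + (t:ℂ) * Complex.I) =
      (Complex.I * E * ((Real.sin φ ^ (lam - 1) : ℝ) : ℂ)) * J := by
    rw [setIntegral_congr_fun measurableSet_Ioi hray, integral_const_mul]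
  have hlim := (((Complex.continuous_re.tendsto _).comp
    (bottom_limit (N := N) hl (by linarith) h0 hπ)).sub
    ((Complex.continuous_re.tendsto _).comp (top_limit hl2 hN h0))).add
    ((Complex.continuous_re.tendsto _).comp ((ray_limit hFi).const_mul Complex.I))
  have hle : ∀ n : ℕ, 1 / ((n:ℝ) + 1) ≤ (n:ℝ) + 2 := by
    intro n
    have : 1 / ((n:ℝ) + 1) ≤ 1 := by
      rw [div_le_one (by positivity)]; linarith [(Nat.cast_nonneg n : (0:ℝ) ≤ n)]
    linarith [(Nat.cast_nonneg n : (0:ℝ) ≤ n)]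
  have hrect := fun n : ℕ =>
    cauchy_rect (lam := lam) (N := N) (φ := φ) (ε := 1 / ((n:ℝ) + 1)) (T := (n:ℝ) + 2)
      h0 hπ (by positivity) (hle n)
  have hlim2 : Tendsto (fun _ : ℕ => (0:ℝ)) atTop _ := hlim.congr hrect
  have hval := tendsto_nhds_unique tendsto_const_nhds hlim2
  rw [hFv] at hval
  -- real part of the bottom integral
  have hreal : ∀ x ∈ Set.Ioo 0 φ, (cf lam N φ (x:ℂ)).re =
      Real.cos (N * x) * (Real.cos x - Real.cos φ) ^ (lam - 1) := by
    intro x hx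
    have hlt := Real.cos_lt_cos_of_nonneg_of_le_pi hx.1.le hπ.le hx.2
    rw [cf, ← Complex.ofReal_cos, ← Complex.ofReal_sub, ← Complex.ofReal_cpow (by linarith),
      Complex.re_mul_ofReal, show Complex.I * N * x = ((N * x : ℝ) : ℂ) * Complex.I by
        push_cast; ring, Complex.exp_ofReal_mul_I_re]
  have hbi : IntegrableOn (fun x : ℝ => cf lam N φ (x:ℂ)) (Set.Ioo 0 φ) := by
    refine Integrable.mono' (kernel_integrable hl h0 hπ) ?_ ?_
    · exact ((cf_measurable lam N φ).comp Complex.measurable_ofReal).aestronglyMeasurable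
    · filter_upwards [ae_restrict_mem measurableSet_Ioo] with x hx
      have hlt := Real.cos_lt_cos_of_nonneg_of_le_pi hx.1.le hπ.le hx.2
      have := cf_norm lam N φ x 0
      simp only [Complex.ofReal_zero, zero_mul, add_zero, mul_zero, neg_zero, Real.exp_zero,
        one_mul] at this
      rw [this, ← Complex.ofReal_cos, ← Complex.ofReal_sub, Complex.norm_real,
        Real.norm_of_nonneg (by linarith)]
  have hre : (∫ x in Set.Ioo (0:ℝ) φ, cf lam N φ x).re =
      ∫ x in Set.Ioo 0 φ, Real.cos (N * x) * (Real.cos x - Real.cos φ) ^ (lam - 1) := by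
    rw [← setIntegral_congr_fun measurableSet_Ioo hreal]
    exact (integral_re hbi).symm
  rw [hre] at hval
  have hI : (Complex.I * (Complex.I * E * ((Real.sin φ ^ (lam - 1) : ℝ) : ℂ) * J)).re =
      - (Real.sin φ ^ (lam - 1) * (E * J).re) := by
    rw [show Complex.I * (Complex.I * E * ((Real.sin φ ^ (lam - 1) : ℝ) : ℂ) * J) =
      (Complex.I * Complex.I) * (((Real.sin φ ^ (lam - 1) : ℝ) : ℂ) * (E * J)) by ring,
      Complex.I_mul_I, neg_one_mul, Complex.neg_re, Complex.re_ofReal_mul]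
  rw [hI, Complex.zero_re] at hval
  linarith

theorem ggf_residual_bound_small_lambda (lam nu : ℝ) (hlam0 : 0 < lam) (hlam2 : lam ≤ 2)
    (hnu : 0 < nu) (hsum : 1 < nu + lam) (φ : ℝ) (hφ : φ ∈ Set.Ioo 0 π) :
    |Real.sin φ ^ lam * rG lam nu (Real.cos φ) -
        (2 ^ lam * Real.Gamma (lam + 1 / 2)) / (Real.sqrt π * (nu + lam) ^ lam) *
          Real.cos ((nu + lam) * φ - lam * π / 2)| ≤
      (lam * |lam - 1| * 2 ^ lam * Real.Gamma (lam + 1 / 2)) /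
          (Real.sqrt π * (nu + lam - 1) ^ (lam + 1)) *
        (|Real.cos φ / Real.sin φ| + 2 / 3 * (lam + 1) / (nu + lam - 1)) := by
  obtain ⟨h0, hπ⟩ := hφ
  have hs : 0 < Real.sin φ := Real.sin_pos_of_pos_of_lt_pi h0 hπ
  have hM := mehler_dirichlet (nu := nu) hlam0 h0 hπ
  rw [contour hlam0 hlam2 hsum h0 hπ] at hM
  have hB := (ray_diff_bound hlam0 hlam2 hsum (Real.cos φ / Real.sin φ)).2
  set N := nu + lam with hN
  set J := ∫ t in Set.Ioi (0:ℝ), ((Real.exp (-(N * t)) : ℝ) : ℂ) *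
          rayM lam (Real.cos φ / Real.sin φ) t with hJ
  set α := N * φ - lam * π / 2 with hα
  set c := Real.cos φ / Real.sin φ with hc
  clear_value N J α c
  set E := Complex.exp ((α : ℂ) * Complex.I) with hE
  have hG : 0 < Real.Gamma lam := Real.Gamma_pos_of_pos hlam0
  have hG2 : 0 < Real.Gamma (lam + 1 / 2) := Real.Gamma_pos_of_pos (by linarith)
  have hsp : 0 < √π := Real.sqrt_pos.mpr Real.pi_pos
  have h2 : (0:ℝ) < 2 ^ lam := Real.rpow_pos_of_pos two_pos lam
  have hNp : 0 < N ^ lam := Real.rpow_pos_of_pos (by linarith) lam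
  have hN1 : 0 < (N - 1) ^ (lam + 1) := Real.rpow_pos_of_pos (by linarith) _
  have hN1' : 0 < N - 1 := by linarith
  have hsl : 0 < Real.sin φ ^ (lam - 1) := Real.rpow_pos_of_pos hs _
  rw [show 2 * lam - 1 = (lam - 1) + lam by ring, Real.rpow_add hs, Real.rpow_neg two_pos.le] at hM
  have hM2 : Real.sin φ ^ lam * rG lam nu (Real.cos φ) =
      2 ^ lam * Real.Gamma (lam + 1 / 2) / (√π * Real.Gamma lam) * (E * J).re := by
    have hM3 : (E * J).re = (2 ^ lam)⁻¹ * √π * Real.Gamma lam / Real.Gamma (lam + 1 / 2) *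
        (Real.sin φ ^ lam * rG lam nu (Real.cos φ)) := by
      apply mul_left_cancel₀ hsl.ne'
      rw [hM]; ring
    rw [hM3]
    field_simp
  have hcos : (E * ((Real.Gamma lam / N ^ lam : ℝ) : ℂ)).re =
      Real.Gamma lam / N ^ lam * Real.cos α := by
    rw [Complex.re_mul_ofReal, hE, Complex.exp_ofReal_mul_I_re]; ring
  have hdiff : Real.sin φ ^ lam * rG lam nu (Real.cos φ) -
        (2 ^ lam * Real.Gamma (lam + 1 / 2)) / (√π * N ^ lam) * Real.cos α =
      2 ^ lam * Real.Gamma (lam + 1 / 2) / (√π * Real.Gamma lam) *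
        (E * (J - ((Real.Gamma lam / N ^ lam : ℝ) : ℂ))).re := by
    rw [mul_sub, Complex.sub_re, hcos, hM2]
    field_simp
  have hn : |(E * (J - ((Real.Gamma lam / N ^ lam : ℝ) : ℂ))).re| ≤
      ‖J - ((Real.Gamma lam / N ^ lam : ℝ) : ℂ)‖ := by
    refine (Complex.abs_re_le_norm _).trans ?_
    rw [norm_mul, hE, Complex.norm_exp_ofReal_mul_I, one_mul]
  rw [hdiff, abs_mul, abs_of_pos (by positivity)]
  calc _ ≤ 2 ^ lam * Real.Gamma (lam + 1 / 2) / (√π * Real.Gamma lam) *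
        (Real.Gamma lam * (lam * |lam - 1| / (N - 1) ^ (lam + 1) *
          (|c| + 2 / 3 * (lam + 1) / (N - 1)))) := by
        gcongr
        exact hn.trans hB
    _ = _ := by
        field_simp
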